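/- arXiv:2605.13410 — 3 statements merged into one kernel-verified Lean document; each statement's English description precedes it below -/
import Mathlib

section
/- Let P = P_0 ∗ P_1 ∗ ⋯ ∗ P_k ⊂ ℝ^{n−k} ⊕ ℝ^k_{≥0} ≅ ℝ^n_{≥0} be a B_k-polytope (so P_0, …, P_k ⊂ ℝ^{n−k} are lattice polytopes with dim(P_1 + ⋯ + P_k) < k and dim(P_0) = n − k) that is convenient in ℝ^n_{≥0}. Then P is negligible, i.e. its Newton number ν(P) = 0. -/
open Pointwise Filter
open scoped Classical

noncomputable section

/-- The integer lattice in `ℝᵃ × ℝᵇ`. -/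
def intLatticeProd (a b : ℕ) : AddSubgroup ((Fin a → ℝ) × (Fin b → ℝ)) where
  carrier := {x | (∀ i, ∃ m : ℤ, x.1 i = (m : ℝ)) ∧ (∀ j, ∃ m : ℤ, x.2 j = (m : ℝ))}
  zero_mem' := ⟨fun i => ⟨0, by simp⟩, fun j => ⟨0, by simp⟩⟩
  add_mem' := by
    rintro x y ⟨hx1, hx2⟩ ⟨hy1, hy2⟩
    constructor
    · intro i
      obtain ⟨p, hp⟩ := hx1 i; obtain ⟨q, hq⟩ := hy1 i
      exact ⟨p + q, by simp [hp, hq]⟩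
    · intro j
      obtain ⟨p, hp⟩ := hx2 j; obtain ⟨q, hq⟩ := hy2 j
      exact ⟨p + q, by simp [hp, hq]⟩
  neg_mem' := by
    rintro x ⟨hx1, hx2⟩
    constructor
    · intro i
      obtain ⟨p, hp⟩ := hx1 i
      exact ⟨-p, by simp [hp]⟩
    · intro j
      obtain ⟨p, hp⟩ := hx2 j
      exact ⟨-p, by simp [hp]⟩

/-- Lattice volume (normalized so that a unit simplex of the lattice `L` has
volume `1`) of a `k`-dimensional set `Q`, defined via asymptotic counting of
lattice points in dilations of `Q`. -/
def latVol {E : Type*} [AddCommGroup E] [Module ℝ E] (L : AddSubgroup E)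
    (k : ℕ) (Q : Set E) : ℝ :=
  Filter.limsup
    (fun t : ℕ => (Nat.factorial k : ℝ) *
      (Nat.card ↥(((t : ℝ) • Q) ∩ (L : Set E))) / (t : ℝ) ^ k) Filter.atTop

/-- The coordinate functions of `ℝᵃ × ℝᵇ`, indexed by `Fin a ⊕ Fin b`. -/
def coordP (a b : ℕ) (idx : Fin a ⊕ Fin b) (x : (Fin a → ℝ) × (Fin b → ℝ)) : ℝ :=
  Sum.elim (fun i => x.1 i) (fun j => x.2 j) idx

/-- The Newton number of a convenient polytope `P ⊆ ℝᵃ⁺ᵇ_{≥0}`: the alternating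
sum `Σ_E (−1)^{n − dim E} Vol_ℤ(P ∩ E)` over all coordinate subspaces `E`. -/
def newtonNumber (a b : ℕ) (P : Set ((Fin a → ℝ) × (Fin b → ℝ))) : ℝ :=
  ∑ σ ∈ (Finset.univ : Finset (Fin a ⊕ Fin b)).powerset,
    (-1 : ℝ) ^ (a + b - σ.card) *
      latVol (intLatticeProd a b) σ.card
        (P ∩ {x | ∀ idx, idx ∉ σ → coordP a b idx x = 0})

/-- The vertices of the Cayley sum: `eVec 0 = 0` and `eVec (i+1) = e_i`. -/
def eVec (b : ℕ) (i : Fin (b + 1)) : Fin b → ℝ :=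
  fun j => if (i : ℕ) = (j : ℕ) + 1 then 1 else 0


/-! ### Lexicographic regular triangulation -/

/-- `d` is lexicographically negative. -/
def LexNeg {n : ℕ} (d : Fin n → ℝ) : Prop := ∃ i, (∀ j, j < i → d j = 0) ∧ d i < 0

theorem LexNeg.add {n : ℕ} {d e : Fin n → ℝ} (hd : LexNeg d) (he : LexNeg e) :
    LexNeg (d + e) := by
  obtain ⟨i, hi, hi'⟩ := hd
  obtain ⟨j, hj, hj'⟩ := he
  rcases lt_trichotomy i j with h | h | h
  · exact ⟨i, fun k hk => by simp [hi k hk, hj k (hk.trans h)], by simp [hj i h, hi']⟩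
  · subst h
    exact ⟨i, fun k hk => by simp [hi k hk, hj k hk], by simp only [Pi.add_apply]; linarith⟩
  · exact ⟨j, fun k hk => by simp [hj k hk, hi k (hk.trans h)], by simp [hi j h, hj']⟩

theorem LexNeg.smul {n : ℕ} {d : Fin n → ℝ} (hd : LexNeg d) {r : ℝ} (hr : 0 < r) :
    LexNeg (r • d) := by
  obtain ⟨i, hi, hi'⟩ := hd
  exact ⟨i, fun k hk => by simp [hi k hk], by simpa using mul_neg_of_pos_of_neg hr hi'⟩

theorem not_lexNeg_zero {n : ℕ} : ¬ LexNeg (0 : Fin n → ℝ) := by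
  rintro ⟨i, -, h⟩
  simp at h

theorem lexNeg_or {n : ℕ} {d : Fin n → ℝ} (hd : d ≠ 0) : LexNeg d ∨ LexNeg (-d) := by
  have hne : (Finset.univ.filter (fun i => d i ≠ 0)).Nonempty := by
    obtain ⟨i, hi⟩ := Function.ne_iff.mp hd
    exact ⟨i, by simpa using hi⟩
  set i := (Finset.univ.filter (fun i => d i ≠ 0)).min' hne with hi
  have h1 : d i ≠ 0 := by
    have := Finset.min'_mem _ hne
    simpa using this
  have h2 : ∀ j, j < i → d j = 0 := by
    intro j hj
    by_contra hc
    have := Finset.min'_le (Finset.univ.filter (fun i => d i ≠ 0)) j (by simpa using hc)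
    exact absurd hj (not_lt.mpr this)
  rcases lt_or_gt_of_ne h1 with h | h
  · exact Or.inl ⟨i, h2, h⟩
  · exact Or.inr ⟨i, fun j hj => by simp [h2 j hj], by simpa using h⟩

theorem not_lexNeg_iff {n : ℕ} {d : Fin n → ℝ} : ¬ LexNeg d ↔ d = 0 ∨ LexNeg (-d) := by
  constructor
  · intro h
    by_cases h0 : d = 0
    · exact Or.inl h0
    · exact Or.inr ((lexNeg_or h0).resolve_left h)
  · rintro (h | h) h'
    · subst h; exact not_lexNeg_zero h'
    · have := h'.add h
      rw [add_neg_cancel] at this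
      exact not_lexNeg_zero this

theorem not_lexNeg_add {n : ℕ} {d e : Fin n → ℝ} (hd : ¬ LexNeg d) (he : ¬ LexNeg e) :
    ¬ LexNeg (d + e) := by
  rw [not_lexNeg_iff] at *
  rcases hd with rfl | hd
  · simpa using he
  · rcases he with rfl | he
    · right; simpa using hd
    · right; rw [neg_add]; exact hd.add he

theorem not_lexNeg_smul {n : ℕ} {d : Fin n → ℝ} (hd : ¬ LexNeg d) {r : ℝ} (hr : 0 ≤ r) :
    ¬ LexNeg (r • d) := by
  rcases hr.eq_or_lt with rfl | hr
  · simpa using not_lexNeg_zero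
  · rw [not_lexNeg_iff] at *
    rcases hd with rfl | hd
    · left; simp
    · right; rw [← smul_neg]; exact hd.smul hr

theorem not_lexNeg_sum {n : ℕ} {κ : Type*} (s : Finset κ) (f : κ → Fin n → ℝ)
    (h : ∀ k ∈ s, ¬ LexNeg (f k)) : ¬ LexNeg (∑ k ∈ s, f k) := by
  induction s using Finset.induction_on with
  | empty => simpa using not_lexNeg_zero
  | insert a s ha ih =>
    rw [Finset.sum_insert ha]
    exact not_lexNeg_add (h a (by simp)) (ih (fun k hk => h k (by simp [hk])))

/-- Existence of the lexicographic minimum of a nonempty compact set. -/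
theorem exists_lexMin {n : ℕ} {K : Set (Fin n → ℝ)} (hK : IsCompact K) (hne : K.Nonempty) :
    ∃ c ∈ K, ∀ c' ∈ K, ¬ LexNeg (c' - c) := by
  have key : ∀ m : ℕ, ∃ c ∈ K, ∀ c' ∈ K, ∀ i : Fin n, (i : ℕ) < m →
      (∀ j, j < i → c' j = c j) → c i ≤ c' i := by
    intro m
    induction m with
    | zero =>
      obtain ⟨c, hc⟩ := hne
      exact ⟨c, hc, fun c' _ i hi => absurd hi (by omega)⟩
    | succ m ih =>
      obtain ⟨c, hc, hmin⟩ := ih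
      by_cases hm : m < n
      · have hcl : IsClosed {c' : Fin n → ℝ | ∀ i : Fin n, (i : ℕ) < m → c' i = c i} := by
          simp only [Set.ofPred_forall]
          refine isClosed_iInter fun i => isClosed_iInter fun _ => ?_
          exact isClosed_eq (continuous_apply i) continuous_const
        have hK' := hK.inter_right hcl
        obtain ⟨c1, hc1, hm1⟩ := hK'.exists_isMinOn ⟨c, hc, fun _ _ => rfl⟩
          (continuous_apply (⟨m, hm⟩ : Fin n)).continuousOn
        refine ⟨c1, hc1.1, fun c' hc' i hi hj => ?_⟩
        have hc1' : ∀ i : Fin n, (i : ℕ) < m → c1 i = c i := hc1.2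
        rcases Nat.lt_succ_iff_lt_or_eq.mp hi with h | h
        · rw [hc1' i h]
          exact hmin c' hc' i h (fun j hji => by
            rw [hj j hji, hc1' j (lt_trans (by exact_mod_cast hji) h)])
        · have hi' : i = ⟨m, hm⟩ := Fin.ext h
          rw [hi']
          refine hm1 ⟨hc', fun j hjm => ?_⟩
          rw [hj j (by rw [hi']; exact hjm), hc1' j hjm]
      · exact ⟨c, hc, fun c' hc' i hi => hmin c' hc' i (by omega)⟩
  obtain ⟨c, hc, hmin⟩ := key n
  refine ⟨c, hc, ?_⟩
  rintro c' hc' ⟨i, hi, hi'⟩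
  have := hmin c' hc' i i.2 (fun j hj => by have := hi j hj; simp only [Pi.sub_apply] at this; linarith)
  simp only [Pi.sub_apply] at hi'
  linarith

/-- Affine dependences of the points `p`. -/
def Dep {n : ℕ} {ι : Type*} (p : Fin n → ι → ℝ) (d : Fin n → ℝ) : Prop :=
  ∑ i, d i = 0 ∧ ∀ k, ∑ i, d i * p i k = 0

theorem Dep.add {n : ℕ} {ι : Type*} {p : Fin n → ι → ℝ} {d e : Fin n → ℝ} (hd : Dep p d)
    (he : Dep p e) : Dep p (d + e) := by
  refine ⟨by simp [Finset.sum_add_distrib, hd.1, he.1], fun k => ?_⟩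
  simp [add_mul, Finset.sum_add_distrib, hd.2 k, he.2 k]

theorem Dep.smul {n : ℕ} {ι : Type*} {p : Fin n → ι → ℝ} {d : Fin n → ℝ} (hd : Dep p d)
    (r : ℝ) : Dep p (r • d) := by
  refine ⟨by simp [← Finset.mul_sum, hd.1], fun k => ?_⟩
  simp [mul_assoc, ← Finset.mul_sum, hd.2 k]

theorem Dep.neg {n : ℕ} {ι : Type*} {p : Fin n → ι → ℝ} {d : Fin n → ℝ} (hd : Dep p d) :
    Dep p (-d) := by
  simpa using hd.smul (-1)

theorem Dep.zero {n : ℕ} {ι : Type*} {p : Fin n → ι → ℝ} : Dep p 0 := by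
  simp [Dep]

theorem Dep.sum {n : ℕ} {ι κ : Type*} {p : Fin n → ι → ℝ} (s : Finset κ) (f : κ → Fin n → ℝ)
    (h : ∀ k ∈ s, Dep p (f k)) : Dep p (∑ k ∈ s, f k) := by
  induction s using Finset.induction_on with
  | empty => simpa using Dep.zero
  | insert a s ha ih =>
    rw [Finset.sum_insert ha]
    exact (h a (by simp)).add (ih (fun k hk => h k (by simp [hk])))

/-- The cells of the lexicographic triangulation. -/
def Good {n : ℕ} {ι : Type*} (p : Fin n → ι → ℝ) (S : Finset (Fin n)) : Prop :=
  ∀ d, Dep p d → (∀ i, i ∉ S → 0 ≤ d i) → ¬ LexNeg d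

theorem Good.mono {n : ℕ} {ι : Type*} {p : Fin n → ι → ℝ} {S T : Finset (Fin n)}
    (h : Good p T) (hST : S ⊆ T) : Good p S :=
  fun d hd hd' => h d hd (fun i hi => hd' i (fun h => hi (hST h)))

theorem Good.unique {n : ℕ} {ι : Type*} {p : Fin n → ι → ℝ} {S T : Finset (Fin n)}
    (hS : Good p S) (hT : Good p T) {c c' : Fin n → ℝ} (hc : ∀ i, i ∉ T → 0 ≤ c i)
    (hc' : ∀ i, i ∉ S → 0 ≤ c' i) (hcS : ∀ i, i ∉ S → c i = 0) (hcT : ∀ i, i ∉ T → c' i = 0)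
    (hdep : Dep p (c' - c)) : c = c' := by
  have h1 := hS _ hdep (fun i hi => by simp [hcS i hi, hc' i hi])
  have h2 := hT _ hdep.neg (fun i hi => by simp [hcT i hi, hc i hi])
  by_contra hne
  rcases lexNeg_or (sub_ne_zero.mpr (Ne.symm hne)) with h | h
  · exact h1 h
  · exact h2 h

theorem Good.indep {n : ℕ} {ι : Type*} {p : Fin n → ι → ℝ} {S : Finset (Fin n)}
    (hS : Good p S) {d : Fin n → ℝ} (hd : Dep p d) (h : ∀ i, i ∉ S → d i = 0) : d = 0 := by
  have := hS.unique hS (c := d) (c' := 0) (fun i hi => (h i hi).ge) (fun _ _ => le_rfl) h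
    (fun _ _ => rfl) (by simpa using hd.neg)
  exact this

theorem exists_good {n : ℕ} {ι : Type*} (p : Fin n → ι → ℝ) (c : Fin n → ℝ)
    (hc : ∀ i, 0 ≤ c i) : ∃ c' : Fin n → ℝ, (∀ i, 0 ≤ c' i) ∧ Dep p (c' - c) ∧
      Good p (Finset.univ.filter (fun i => c' i ≠ 0)) := by
  set K : Set (Fin n → ℝ) := {c' | (∀ i, 0 ≤ c' i) ∧ Dep p (c' - c)} with hKdef
  have hcl : IsClosed K := by
    have h1 : IsClosed {c' : Fin n → ℝ | ∀ i, 0 ≤ c' i} := by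
      simp only [Set.ofPred_forall]
      exact isClosed_iInter fun i => isClosed_le continuous_const (continuous_apply i)
    have h2 : IsClosed {c' : Fin n → ℝ | Dep p (c' - c)} := by
      unfold Dep
      refine IsClosed.and (isClosed_eq (by fun_prop) continuous_const) ?_
      simp only [Set.ofPred_forall]
      exact isClosed_iInter fun k => isClosed_eq (by fun_prop) continuous_const
    exact h1.inter h2
  have hcomp : IsCompact K := by
    refine IsCompact.of_isClosed_subset
      (isCompact_univ_pi (fun _ : Fin n => isCompact_Icc (a := (0 : ℝ)) (b := ∑ i, c i))) hcl ?_
    rintro c' ⟨h1, h2⟩ i -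
    refine ⟨h1 i, ?_⟩
    have h3 := h2.1
    simp only [Pi.sub_apply, Finset.sum_sub_distrib] at h3
    have := Finset.single_le_sum (f := c') (fun i _ => h1 i) (Finset.mem_univ i)
    linarith
  obtain ⟨c', ⟨h1, h2⟩, hmin⟩ := exists_lexMin hcomp
    ⟨c, hc, by rw [sub_self]; exact Dep.zero⟩
  refine ⟨c', h1, h2, ?_⟩
  intro d hd hd' hneg
  -- a small step in direction `d`
  have hstep : ∃ ε : ℝ, 0 < ε ∧ ∀ i, 0 ≤ c' i + ε * d i := by
    have : ∀ i, ∀ᶠ ε in nhdsWithin (0 : ℝ) (Set.Ioi 0), 0 ≤ c' i + ε * d i := by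
      intro i
      by_cases hi : c' i = 0
      · filter_upwards [self_mem_nhdsWithin] with ε hε
        have : 0 ≤ d i := hd' i (by simp [hi])
        rw [hi, zero_add]
        exact mul_nonneg (le_of_lt hε) this
      · have hpos : 0 < c' i := lt_of_le_of_ne (h1 i) (Ne.symm hi)
        have ht : Tendsto (fun ε : ℝ => c' i + ε * d i) (nhdsWithin 0 (Set.Ioi 0))
            (nhds (c' i + 0 * d i)) := by
          apply Tendsto.mono_left _ nhdsWithin_le_nhds
          exact (Continuous.tendsto (by fun_prop) 0)
        filter_upwards [ht.eventually (lt_mem_nhds (by simpa using hpos : 0 < c' i + 0 * d i))]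
          with ε hε using hε.le
    have h := (Filter.eventually_all.mpr this).and self_mem_nhdsWithin
    obtain ⟨ε, h1, h2⟩ := h.exists
    exact ⟨ε, h2, h1⟩
  obtain ⟨ε, hε, hnn⟩ := hstep
  refine hmin (c' + ε • d) ⟨fun i => by simpa using hnn i, ?_⟩ ?_
  · have := h2.add (hd.smul ε)
    convert this using 1
    abel
  · rw [add_sub_cancel_left]
    exact hneg.smul hε

theorem good_card_le {n : ℕ} {ι : Type*} {p : Fin n → ι → ℝ} {S : Finset (Fin n)} (hS : Good p S)
    {σ : Finset ι} (hσ : ∀ i ∈ S, ∀ k, k ∉ σ → p i k = 0) :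
    S.card ≤ σ.card + 1 ∧ (S.card = σ.card + 1 → ∀ (m : ℝ) (x : ι → ℝ), (∀ k, k ∉ σ → x k = 0) →
      ∃ d : Fin n → ℝ, (∀ i, i ∉ S → d i = 0) ∧ ∑ i, d i = m ∧ ∀ k, ∑ i, d i * p i k = x k) := by
  let ext : (S → ℝ) → Fin n → ℝ := fun c i => if h : i ∈ S then c ⟨i, h⟩ else 0
  have hext0 : ∀ c i, i ∉ S → ext c i = 0 := fun c i hi => by simp [ext, hi]
  have hsum : ∀ (c : S → ℝ) (f : Fin n → ℝ), ∑ i, ext c i * f i = ∑ i : S, c i * f i := by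
    intro c f
    rw [← Finset.sum_subset (Finset.subset_univ S)
      (fun i _ hi => by rw [hext0 c i hi, zero_mul]), ← Finset.sum_coe_sort S]
    refine Finset.sum_congr rfl fun i _ => ?_
    simp [ext]
  let Ψ : (S → ℝ) →ₗ[ℝ] (Option σ → ℝ) :=
    LinearMap.pi (fun o => ∑ i : S, (Option.elim o 1 (fun k : σ => p i k)) • LinearMap.proj i)
  have hΨ : ∀ c o, Ψ c o = ∑ i : S, c i * (Option.elim o 1 (fun k : σ => p i k)) := by
    intro c o
    simp [Ψ, mul_comm]
  have hall : ∀ c : S → ℝ, ∀ k, k ∉ σ → ∑ i, ext c i * p i k = 0 := by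
    intro c k hk
    rw [hsum c (fun i => p i k)]
    exact Finset.sum_eq_zero fun i _ => by rw [hσ i i.2 k hk, mul_zero]
  have hinj : Function.Injective Ψ := by
    rw [← LinearMap.ker_eq_bot, LinearMap.ker_eq_bot']
    intro c hc
    have hd : Dep p (ext c) := by
      refine ⟨?_, fun k => ?_⟩
      · have := congrFun hc none
        rw [hΨ] at this
        have h2 := hsum c (fun _ => 1)
        simp at h2 this
        rw [h2, this]
      · by_cases hk : k ∈ σ
        · have := congrFun hc (some ⟨k, hk⟩)
          rw [hΨ] at this
          rw [hsum c (fun i => p i k)]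
          simpa using this
        · exact hall c k hk
    have h0 := hS.indep hd (hext0 c)
    ext i
    have := congrFun h0 i
    simpa [ext] using this
  have hcard : Module.finrank ℝ (Option σ → ℝ) = σ.card + 1 := by simp
  have hcardS : Module.finrank ℝ (S → ℝ) = S.card := by simp
  refine ⟨?_, ?_⟩
  · have := LinearMap.finrank_le_finrank_of_injective hinj
    rwa [hcard, hcardS] at this
  · intro hEq m x hx
    have hsurj := (LinearMap.injective_iff_surjective_of_finrank_eq_finrank
      (by rw [hcard, hcardS, hEq])).mp hinj
    obtain ⟨c, hc⟩ := hsurj (fun o => Option.elim o m (fun k : σ => x k))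
    refine ⟨ext c, hext0 c, ?_, fun k => ?_⟩
    · have := congrFun hc none
      rw [hΨ] at this
      have h2 := hsum c (fun _ => 1)
      simp at h2 this
      rw [h2, this]
    · by_cases hk : k ∈ σ
      · have := congrFun hc (some ⟨k, hk⟩)
        rw [hΨ] at this
        rw [hsum c (fun i => p i k)]
        simpa using this
      · rw [hall c k hk, hx k hk]


theorem good_extend_unique {n : ℕ} {ι : Type*} [DecidableEq ι] {p : Fin n → ι → ℝ}
    {S : Finset (Fin n)} (hS : Good p S) {σ : Finset ι} (hσ : ∀ i ∈ S, ∀ k, k ∉ σ → p i k = 0)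
    (hcard : S.card = σ.card + 1) {k0 : ι} (hk0 : k0 ∉ σ) {v v' : Fin n}
    (hv1 : p v k0 = 1) (hv : ∀ k, k ∉ insert k0 σ → p v k = 0)
    (hv1' : p v' k0 = 1) (hv' : ∀ k, k ∉ insert k0 σ → p v' k = 0)
    (hg : Good p (insert v S)) (hg' : Good p (insert v' S)) : v = v' := by
  obtain ⟨D, hD0, hD1, hD2⟩ := (good_card_le hS hσ).2 hcard 0 (p v - p v') (by
    intro k hk
    by_cases h : k = k0
    · subst h; simp [hv1, hv1']
    · simp [hv k (by simp [h, hk]), hv' k (by simp [h, hk])])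
  have hvS : v ∉ S := fun h => by have := hσ v h k0 hk0; rw [hv1] at this; norm_num at this
  have hEq := hg.unique hg' (c := Pi.single v 1) (c' := Pi.single v' 1 + D)
    (by intro i hi; rw [Pi.single_apply]; split_ifs <;> norm_num)
    (by
      intro i hi
      rw [Pi.add_apply, hD0 i (fun h => hi (by simp [h])), Pi.single_apply]
      split_ifs <;> norm_num)
    (by
      intro i hi
      rw [Pi.single_apply, if_neg]
      rintro rfl
      simp at hi)
    (by
      intro i hi
      rw [Pi.add_apply, hD0 i (fun h => hi (by simp [h])), Pi.single_apply, if_neg, zero_add]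
      rintro rfl
      simp at hi)
    (by
      constructor
      · simp [Finset.sum_add_distrib, hD1]
      · intro k
        simp only [Pi.sub_apply, Pi.add_apply, sub_mul, add_mul, Finset.sum_sub_distrib,
          Finset.sum_add_distrib, hD2]
        simp [Pi.single_apply])
  have := congrFun hEq v
  rw [Pi.add_apply, hD0 v hvS, Pi.single_eq_same, Pi.single_apply] at this
  by_contra hne
  simp [hne] at this

set_option maxHeartbeats 400000 in
theorem good_extend {n : ℕ} {ι : Type*} [DecidableEq ι] {p : Fin n → ι → ℝ}
    (hnn : ∀ i k, 0 ≤ p i k)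
    {S : Finset (Fin n)} (hS : Good p S) {σ : Finset ι} (hσ : ∀ i ∈ S, ∀ k, k ∉ σ → p i k = 0)
    (hcard : S.card = σ.card + 1) {k0 : ι} (hk0 : k0 ∉ σ)
    (h01 : ∀ i, p i k0 = 0 ∨ p i k0 = 1)
    {e : Fin n} (he1 : p e k0 = 1) (he : ∀ k, k ∉ insert k0 σ → p e k = 0) :
    ∃ v, p v k0 = 1 ∧ (∀ k, k ∉ insert k0 σ → p v k = 0) ∧ Good p (insert v S) := by
  classical
  set L : Finset (Fin n) :=
    Finset.univ.filter (fun u => p u k0 = 1 ∧ ∀ k, k ∉ insert k0 σ → p u k = 0) with hL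
  have hmemL : ∀ u, u ∈ L ↔ p u k0 = 1 ∧ ∀ k, k ∉ insert k0 σ → p u k = 0 := by
    intro u; simp only [hL, Finset.mem_filter, Finset.mem_univ, true_and]
  have heL : e ∈ L := (hmemL e).2 ⟨he1, he⟩
  have hD : ∀ u : Fin n, ∃ D : Fin n → ℝ, u ∈ L → (∀ i, i ∉ S → D i = 0) ∧ ∑ i, D i = 0 ∧
      ∀ k, ∑ i, D i * p i k = (p u - p e) k := by
    intro u
    by_cases hu : u ∈ L
    · have hu' := (hmemL u).1 hu
      obtain ⟨D, h⟩ := (good_card_le hS hσ).2 hcard 0 (p u - p e) (by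
        intro k hk
        by_cases h : k = k0
        · subst h; simp [hu'.1, he1]
        · simp [hu'.2 k (by simp [h, hk]), he k (by simp [h, hk])])
      exact ⟨D, fun _ => h⟩
    · exact ⟨0, fun h => absurd h hu⟩
  choose D hD using hD
  set r : Fin n → Fin n → ℝ := fun u => Pi.single u 1 - D u - Pi.single e 1 with hr
  have hrdep : ∀ u ∈ L, Dep p (r u) := by
    intro u hu
    obtain ⟨h1, h2, h3⟩ := hD u hu
    constructor
    · simp [hr, Finset.sum_sub_distrib, h2]
    · intro k
      simp only [hr, Pi.sub_apply, sub_mul, Finset.sum_sub_distrib, h3]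
      simp [Pi.single_apply]
  obtain ⟨_, ⟨v, hvL, rfl⟩, hmin⟩ := exists_lexMin (K := r '' (L : Set (Fin n)))
    ((L.finite_toSet.image r).isCompact) ⟨r e, e, heL, rfl⟩
  have hv := (hmemL v).1 hvL
  refine ⟨v, hv.1, hv.2, ?_⟩
  have hvS : ∀ u ∈ L, u ∉ S := fun u hu h => by
    have := hσ u h k0 hk0; rw [((hmemL u).1 hu).1] at this; norm_num at this
  intro d hd hdnn
  -- `d` is supported on the face
  have hface : ∀ i, (∃ k, k ∉ insert k0 σ ∧ p i k ≠ 0) → d i = 0 := by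
    rintro i ⟨k, hk, hik⟩
    have hsum := hd.2 k
    have hz : ∀ i' ∈ insert v S, p i' k = 0 := by
      intro i' hi'
      rcases Finset.mem_insert.1 hi' with rfl | h
      · exact hv.2 k hk
      · exact hσ i' h k (fun h => hk (by simp [h]))
    have hnn' : ∀ i' ∈ Finset.univ, 0 ≤ d i' * p i' k := by
      intro i' _
      by_cases hi' : i' ∈ insert v S
      · simp [hz i' hi']
      · exact mul_nonneg (hdnn i' hi') (hnn i' k)
    have := (Finset.sum_eq_zero_iff_of_nonneg hnn').1 hsum i (Finset.mem_univ i)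
    exact (mul_eq_zero.1 this).resolve_right hik
  have hLsum : ∑ u ∈ L, d u = 0 := by
    have hsum := hd.2 k0
    rw [← Finset.sum_subset (Finset.subset_univ L)] at hsum
    · rw [← hsum]
      exact Finset.sum_congr rfl fun u hu => by rw [((hmemL u).1 hu).1, mul_one]
    · intro i _ hi
      rcases h01 i with h | h
      · rw [h, mul_zero]
      · have : ∃ k, k ∉ insert k0 σ ∧ p i k ≠ 0 := by
          by_contra hc
          push Not at hc
          exact hi ((hmemL i).2 ⟨h, hc⟩)
        rw [hface i this, zero_mul]
  set d' := d - ∑ u ∈ L, d u • r u with hd'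
  have hd'dep : Dep p d' := by
    rw [hd', sub_eq_add_neg]
    exact hd.add (Dep.sum L _ (fun u hu => (hrdep u hu).smul _)).neg
  have hd'nn : ¬ LexNeg d' := by
    refine hS d' hd'dep fun i hi => ?_
    have hri : ∑ u ∈ L, d u * r u i = if i ∈ L then d i else 0 := by
      have : ∀ u ∈ L, d u * r u i
          = (if u = i then d i else 0) - d u * (Pi.single e (1 : ℝ) : Fin n → ℝ) i := by
        intro u hu
        have h0 : r u i = (Pi.single u (1 : ℝ) : Fin n → ℝ) i - D u i
            - (Pi.single e (1 : ℝ) : Fin n → ℝ) i := rfl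
        rw [h0, (hD u hu).1 i hi, sub_zero, mul_sub]
        congr 1
        by_cases h : u = i
        · rw [if_pos h, ← h, Pi.single_eq_same, mul_one]
        · rw [if_neg h, Pi.single_eq_of_ne (Ne.symm h), mul_zero]
      rw [Finset.sum_congr rfl this, Finset.sum_sub_distrib, ← Finset.sum_mul, hLsum, zero_mul,
        sub_zero, Finset.sum_ite_eq']
    have : d' i = d i - if i ∈ L then d i else 0 := by
      rw [← hri]; simp [hd']
    rw [this]
    split_ifs with h
    · simp
    · rw [sub_zero]
      refine hdnn i ?_
      simp only [Finset.mem_insert, not_or]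
      exact ⟨fun h' => h (h' ▸ hvL), hi⟩
  have hre : d = d' + ∑ u ∈ L, d u • (r u - r v) := by
    rw [hd']
    simp only [smul_sub, Finset.sum_sub_distrib, ← Finset.sum_smul, hLsum]
    simp
  rw [hre]
  refine not_lexNeg_add hd'nn (not_lexNeg_sum _ _ fun u hu => ?_)
  by_cases huv : u = v
  · subst huv
    simpa using not_lexNeg_zero
  · refine not_lexNeg_smul (hmin _ ⟨u, hu, rfl⟩) (hdnn u ?_)
    simp only [Finset.mem_insert, not_or]
    exact ⟨huv, hvS u hu⟩


/-! ### Volumes of sections -/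

/-- convex hull of the points `p i`, `i ∈ S`. -/
def hullS {n : ℕ} {ι : Type*} (p : Fin n → ι → ℝ) (S : Finset (Fin n)) : Set (ι → ℝ) :=
  {x | ∃ c : Fin n → ℝ, (∀ i, 0 ≤ c i) ∧ (∀ i, i ∉ S → c i = 0) ∧ ∑ i, c i = 1 ∧
    ∀ k, ∑ i, c i * p i k = x k}

/-- The section of `Q` by the coordinate subspace `σ`. -/
def sec {ι : Type*} [DecidableEq ι] (σ : Finset ι) (Q : Set (ι → ℝ)) : Set (σ → ℝ) :=
  {y | Function.updateFinset (0 : ι → ℝ) σ y ∈ Q}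

theorem hullS_mono {n : ℕ} {ι : Type*} (p : Fin n → ι → ℝ) {S T : Finset (Fin n)} (h : S ⊆ T) :
    hullS p S ⊆ hullS p T := by
  rintro x ⟨c, h1, h2, h3⟩
  exact ⟨c, h1, fun i hi => h2 i (fun h' => hi (h h')), h3⟩

theorem isCompact_hullS {n : ℕ} {ι : Type*} (p : Fin n → ι → ℝ) (S : Finset (Fin n)) :
    IsCompact (hullS p S) := by
  have hK : IsCompact {c : Fin n → ℝ | (∀ i, 0 ≤ c i) ∧ (∀ i, i ∉ S → c i = 0) ∧ ∑ i, c i = 1} := by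
    refine IsCompact.of_isClosed_subset
      (isCompact_univ_pi (fun _ : Fin n => isCompact_Icc (a := (0 : ℝ)) (b := 1))) ?_ ?_
    · refine IsClosed.and ?_ (IsClosed.and ?_ ?_)
      · simp only [Set.ofPred_forall]
        exact isClosed_iInter fun i => isClosed_le continuous_const (continuous_apply i)
      · simp only [Set.ofPred_forall]
        exact isClosed_iInter fun i => isClosed_iInter fun _ =>
          isClosed_eq (continuous_apply i) continuous_const
      · exact isClosed_eq (by fun_prop) continuous_const
    · rintro c ⟨h1, h2, h3⟩ i -
      refine ⟨h1 i, ?_⟩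
      rw [← h3]
      exact Finset.single_le_sum (f := c) (fun i _ => h1 i) (Finset.mem_univ i)
  have := hK.image (f := fun c k => ∑ i, c i * p i k) (by fun_prop)
  convert this using 1
  ext x
  constructor
  · rintro ⟨c, h1, h2, h3, h4⟩
    exact ⟨c, ⟨h1, h2, h3⟩, funext h4⟩
  · rintro ⟨c, ⟨h1, h2, h3⟩, rfl⟩
    exact ⟨c, h1, h2, h3, fun k => rfl⟩

theorem continuous_ext0 {ι : Type*} [DecidableEq ι] (x : ι → ℝ) (σ : Finset ι) :
    Continuous (fun y : σ → ℝ => Function.updateFinset x σ y) := by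
  refine continuous_pi fun k => ?_
  by_cases hk : k ∈ σ
  · simp only [Function.updateFinset, hk, dif_pos]
    exact continuous_apply _
  · simp only [Function.updateFinset, hk, dif_neg, not_false_eq_true]
    exact continuous_const

theorem isCompact_sec {ι : Type*} [DecidableEq ι] (σ : Finset ι) {Q : Set (ι → ℝ)}
    (hQ : IsCompact Q) : IsCompact (sec σ Q) := by
  have hcont : Continuous (fun (x : ι → ℝ) (k : σ) => x k) := by fun_prop
  refine IsCompact.of_isClosed_subset (hQ.image hcont)
    (hQ.isClosed.preimage (continuous_ext0 0 σ)) ?_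
  intro y hy
  refine ⟨_, hy, ?_⟩
  ext k
  simp [Function.updateFinset]

theorem sec_null {n : ℕ} {ι : Type*} [DecidableEq ι] (p : Fin n → ι → ℝ) {S : Finset (Fin n)}
    {σ : Finset ι} (h : S.card ≤ σ.card) : MeasureTheory.volume (sec σ (hullS p S)) = 0 := by
  rcases S.eq_empty_or_nonempty with rfl | hne
  · have : sec σ (hullS p ∅) = ∅ := by
      rw [Set.eq_empty_iff_forall_notMem]
      rintro y ⟨c, h1, h2, h3, h4⟩
      rw [Finset.sum_eq_zero (fun i _ => h2 i (by simp))] at h3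
      norm_num at h3
    rw [this, MeasureTheory.measure_empty]
  · let q : Fin n → σ → ℝ := fun i k => p i k
    have hsub : sec σ (hullS p S) ⊆ (affineSpan ℝ ((S.image q : Finset (σ → ℝ)) : Set (σ → ℝ)) :
        Set (σ → ℝ)) := by
      rintro y ⟨c, h1, h2, h3, h4⟩
      apply convexHull_subset_affineSpan
      have hy : y = ∑ i ∈ S, c i • q i := by
        ext k
        have := h4 k
        rw [← Finset.sum_subset (Finset.subset_univ S)
          (fun i _ hi => by rw [h2 i hi, zero_mul])] at this
        simp only [Function.updateFinset, k.2, dif_pos] at this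
        simp [q, this]
      rw [hy]
      refine (convex_convexHull ℝ _).sum_mem (fun i _ => h1 i) ?_ (fun i hi => ?_)
      · rw [← h3]
        exact Finset.sum_subset (Finset.subset_univ S) (fun i _ hi => h2 i hi)
      · exact subset_convexHull ℝ _ (by simpa using ⟨i, hi, rfl⟩)
    refine MeasureTheory.measure_mono_null hsub
      (MeasureTheory.Measure.addHaar_affineSubspace _ _ ?_)
    intro htop
    obtain ⟨m, hm⟩ : ∃ m, S.card = m + 1 := ⟨S.card - 1, by have := hne.card_pos; omega⟩
    have h1 := finrank_vectorSpan_image_finset_le ℝ q S hm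
    have h2 : vectorSpan ℝ ((S.image q : Finset (σ → ℝ)) : Set (σ → ℝ)) = ⊤ := by
      rw [← direction_affineSpan, htop, AffineSubspace.direction_top]
    rw [h2] at h1
    simp at h1
    omega

/-- The maximal cells in the coordinate subspace `σ`. -/
def cells {n : ℕ} {ι : Type*} (p : Fin n → ι → ℝ) (σ : Finset ι) : Finset (Finset (Fin n)) :=
  Finset.univ.filter (fun S => Good p S ∧ (∀ i ∈ S, ∀ k, k ∉ σ → p i k = 0) ∧
    S.card = σ.card + 1)

theorem mem_cells {n : ℕ} {ι : Type*} {p : Fin n → ι → ℝ} {σ : Finset ι} {S : Finset (Fin n)} :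
    S ∈ cells p σ ↔ Good p S ∧ (∀ i ∈ S, ∀ k, k ∉ σ → p i k = 0) ∧ S.card = σ.card + 1 := by
  simp [cells]

theorem vol_eq_sum_cells {n : ℕ} {ι : Type*} [DecidableEq ι] {p : Fin n → ι → ℝ}
    (hnn : ∀ i k, 0 ≤ p i k) (σ : Finset ι) :
    MeasureTheory.volume (sec σ (hullS p Finset.univ))
      = ∑ S ∈ cells p σ, MeasureTheory.volume (sec σ (hullS p S)) := by
  rw [← MeasureTheory.measure_biUnion_finset₀]
  · apply le_antisymm
    · have hsub : sec σ (hullS p Finset.univ) ⊆ (⋃ S ∈ cells p σ, sec σ (hullS p S)) ∪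
          ⋃ S ∈ (Finset.univ.filter (fun S : Finset (Fin n) => S.card ≤ σ.card)),
            sec σ (hullS p S) := by
        rintro y ⟨c, h1, -, h3, h4⟩
        obtain ⟨c', h1', hdep, hgood⟩ := exists_good p c h1
        have hs : ∑ i, c' i = 1 := by
          have := hdep.1
          simp only [Pi.sub_apply, Finset.sum_sub_distrib] at this
          linarith
        have hs' : ∀ k, ∑ i, c' i * p i k = Function.updateFinset (0 : ι → ℝ) σ y k := by
          intro k
          have := hdep.2 k
          simp only [Pi.sub_apply, sub_mul, Finset.sum_sub_distrib] at this
          rw [← h4 k]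
          linarith
        have hmem : y ∈ sec σ (hullS p (Finset.univ.filter (fun i => c' i ≠ 0))) :=
          ⟨c', h1', fun i hi => by simpa using hi, hs, hs'⟩
        have hface : ∀ i ∈ Finset.univ.filter (fun i => c' i ≠ 0), ∀ k, k ∉ σ → p i k = 0 := by
          intro i hi k hk
          have h := hs' k
          rw [Function.updateFinset, dif_neg hk, Pi.zero_apply] at h
          have := (Finset.sum_eq_zero_iff_of_nonneg
            (fun i _ => mul_nonneg (h1' i) (hnn i k))).1 h i (Finset.mem_univ i)
          exact (mul_eq_zero.1 this).resolve_left (by simpa using hi)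
        have hcard := (good_card_le hgood hface).1
        rcases hcard.lt_or_eq with h | h
        · right
          simp only [Set.mem_iUnion]
          exact ⟨_, Finset.mem_filter.2 ⟨Finset.mem_univ _, by omega⟩, hmem⟩
        · left
          simp only [Set.mem_iUnion]
          exact ⟨_, mem_cells.2 ⟨hgood, hface, h⟩, hmem⟩
      refine (MeasureTheory.measure_mono hsub).trans
        ((MeasureTheory.measure_union_le _ _).trans ?_)
      have hnull : MeasureTheory.volume
          (⋃ S ∈ (Finset.univ.filter (fun S : Finset (Fin n) => S.card ≤ σ.card)),
            sec σ (hullS p S)) = 0 :=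
        (MeasureTheory.measure_biUnion_null_iff (Finset.countable_toSet _)).2
          fun S hS => sec_null p (Finset.mem_filter.1 hS).2
      rw [hnull, add_zero]
    · refine MeasureTheory.measure_mono ?_
      refine Set.iUnion₂_subset fun S _ => ?_
      exact fun y hy => hullS_mono p (Finset.subset_univ S) hy
  · intro S hS T hT hne
    have hS' := mem_cells.1 hS
    have hT' := mem_cells.1 hT
    refine MeasureTheory.measure_mono_null ?_ (sec_null p (S := S ∩ T) (σ := σ) ?_)
    · rintro y ⟨⟨c, h1, h2, h3, h4⟩, ⟨c', h1', h2', h3', h4'⟩⟩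
      have : c = c' := hS'.1.unique hT'.1 (fun i _ => h1 i) (fun i _ => h1' i) h2 h2'
        ⟨by simp [Finset.sum_sub_distrib, h3, h3'],
          fun k => by simp [sub_mul, Finset.sum_sub_distrib, h4 k, h4' k]⟩
      subst this
      refine ⟨c, h1, fun i hi => ?_, h3, h4⟩
      by_cases hiS : i ∈ S
      · exact h2' i (fun h => hi (by simp [hiS, h]))
      · exact h2 i hiS
    · have hlt : (S ∩ T).card < S.card := by
        refine Finset.card_lt_card (Finset.inter_subset_left.ssubset_of_ne ?_)
        intro h
        have hsub : S ⊆ T := Finset.inter_eq_left.1 h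
        exact hne (Finset.eq_of_subset_of_card_le hsub (by rw [hS'.2.2, hT'.2.2]))
      have := hS'.2.2
      omega
  · intro S _
    exact (isCompact_sec σ (isCompact_hullS p S)).isClosed.measurableSet.nullMeasurableSet


theorem lintegral_pyr (d : ℕ) :
    ∫⁻ h in Set.Ico (0 : ℝ) 1, ENNReal.ofReal ((1 - h) ^ d) = ENNReal.ofReal (1 / (d + 1)) := by
  rw [← MeasureTheory.ofReal_integral_eq_lintegral_ofReal]
  · rw [MeasureTheory.integral_Ico_eq_integral_Ioc,
      ← intervalIntegral.integral_of_le zero_le_one,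
      intervalIntegral.integral_comp_sub_left (fun x : ℝ => x ^ d) 1]
    simp
  · have : MeasureTheory.IntegrableOn (fun h : ℝ => (1 - h) ^ d) (Set.Icc 0 1) :=
      (by fun_prop : Continuous (fun h : ℝ => (1 - h) ^ d)).continuousOn.integrableOn_Icc
    exact this.mono_set Set.Ico_subset_Icc_self
  · refine (MeasureTheory.ae_restrict_iff' measurableSet_Ico).2 (Filter.Eventually.of_forall ?_)
    intro h hh
    exact pow_nonneg (by linarith [hh.2]) d

theorem slice_eq {n : ℕ} {ι : Type*} [DecidableEq ι] {p : Fin n → ι → ℝ}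
    {S : Finset (Fin n)} {σ : Finset ι} (hσ : ∀ i ∈ S, ∀ k, k ∉ σ → p i k = 0)
    {k0 : ι} (hk0 : k0 ∉ σ) {v : Fin n}
    (hv1 : p v k0 = 1) (hv : ∀ k, k ∉ insert k0 σ → p v k = 0) (h : ℝ) :
    (h ∈ Set.Ico (0 : ℝ) 1 →
      {y : σ → ℝ | Function.updateFinset (Function.update (0 : ι → ℝ) k0 h) σ y
        ∈ hullS p (insert v S)} = (h • fun k : σ => p v k) +ᵥ ((1 - h) • sec σ (hullS p S))) ∧
    (h ∉ Set.Icc (0 : ℝ) 1 →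
      {y : σ → ℝ | Function.updateFinset (Function.update (0 : ι → ℝ) k0 h) σ y
        ∈ hullS p (insert v S)} = ∅) := by
  have hvS : v ∉ S := fun h => by have := hσ v h k0 hk0; rw [hv1] at this; norm_num at this
  have hcv : ∀ c : Fin n → ℝ, (∀ i, i ∉ insert v S → c i = 0) → ∀ y : σ → ℝ,
      (∀ k, ∑ i, c i * p i k
        = Function.updateFinset (Function.update (0 : ι → ℝ) k0 h) σ y k) → c v = h := by
    intro c h2 y h4
    have := h4 k0
    rw [Function.updateFinset, dif_neg hk0, Function.update_self, Finset.sum_eq_single v, hv1,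
      mul_one] at this
    · exact this
    · intro i _ hi
      by_cases hiS : i ∈ S
      · rw [hσ i hiS k0 hk0, mul_zero]
      · rw [h2 i (by simp [hi, hiS]), zero_mul]
    · simp
  constructor
  · rintro ⟨hh0, hh1⟩
    have h1h : (1 - h) ≠ 0 := by linarith
    ext y
    constructor
    · rintro ⟨c, h1, h2, h3, h4⟩
      have hc := hcv c h2 y h4
      set c' : Fin n → ℝ := fun i => (1 - h)⁻¹ * (c i - Pi.single (M := fun _ => ℝ) v h i) with hc'
      have hsum : ∀ f : Fin n → ℝ, ∑ i, c' i * f i = (1 - h)⁻¹ * (∑ i, c i * f i - h * f v) := by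
        intro f
        simp only [hc', mul_assoc, ← Finset.mul_sum, sub_mul, Finset.sum_sub_distrib]
        congr 2
        rw [Finset.sum_eq_single v]
        · simp
        · intro i _ hi
          simp [hi]
        · simp
      have hS0 : ∀ i, i ∉ S → c' i = 0 := by
        intro i hi
        by_cases hiv : i = v
        · subst hiv; simp [hc', hc]
        · simp [hc', hiv, h2 i (by simp [hi, hiv])]
      refine ⟨(1 - h) • fun k : σ => ∑ i, c' i * p i k, ⟨_, ?_, rfl⟩, ?_⟩
      · refine ⟨c', fun i => ?_, hS0, ?_, fun k => ?_⟩
        · by_cases hiv : i = v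
          · subst hiv; simp [hc', hc]
          · simp only [hc', Pi.single_eq_of_ne hiv, sub_zero]
            exact mul_nonneg (inv_nonneg.2 (by linarith)) (h1 i)
        · have := hsum (fun _ => 1)
          simp only [mul_one, h3] at this
          rw [this, inv_mul_cancel₀ h1h]
        · by_cases hk : k ∈ σ
          · simp [Function.updateFinset, hk]
          · simp only [Function.updateFinset, hk, dif_neg, not_false_eq_true, Pi.zero_apply]
            refine Finset.sum_eq_zero fun i _ => ?_
            by_cases hiS : i ∈ S
            · rw [hσ i hiS k hk, mul_zero]
            · rw [hS0 i hiS, zero_mul]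
      · ext k
        have := h4 k
        simp only [Function.updateFinset, k.2, dif_pos] at this
        simp only [vadd_eq_add, Pi.add_apply, Pi.smul_apply, smul_eq_mul,
          hsum (fun i => p i k), this]
        rw [← mul_assoc, mul_inv_cancel₀ h1h]
        ring
    · rintro ⟨_, ⟨y', ⟨c, h1, h2, h3, h4⟩, rfl⟩, rfl⟩
      refine ⟨fun i => (1 - h) * c i + Pi.single (M := fun _ => ℝ) v h i, fun i => ?_,
        fun i hi => ?_, ?_, fun k => ?_⟩
      · have : 0 ≤ Pi.single (M := fun _ => ℝ) v h i := by
          rw [Pi.single_apply]; split_ifs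
          · exact hh0
          · exact le_rfl
        have := mul_nonneg (by linarith : 0 ≤ 1 - h) (h1 i)
        linarith
      · simp only [Finset.mem_insert, not_or] at hi
        simp [h2 i hi.2, hi.1]
      · simp [Finset.sum_add_distrib, ← Finset.mul_sum, h3]
      · have hs : ∑ i, ((1 - h) * c i + Pi.single (M := fun _ => ℝ) v h i) * p i k
            = (1 - h) * ∑ i, c i * p i k + h * p v k := by
          simp only [add_mul, mul_assoc, Finset.sum_add_distrib, ← Finset.mul_sum]
          congr 1
          rw [Finset.sum_eq_single v]
          · simp
          · intro i _ hi
            simp [hi]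
          · simp
        rw [hs, h4 k]
        by_cases hk : k ∈ σ
        · simp [Function.updateFinset, hk, add_comm]
        · simp only [Function.updateFinset, hk, dif_neg, not_false_eq_true, Pi.zero_apply]
          by_cases hkk : k = k0
          · subst hkk; simp [hv1]
          · simp [hkk, hv k (by simp [hk, hkk])]
  · intro hh
    rw [Set.eq_empty_iff_forall_notMem]
    rintro y ⟨c, h1, h2, h3, h4⟩
    have hc := hcv c h2 y h4
    apply hh
    rw [← hc]
    refine ⟨h1 v, ?_⟩
    rw [← h3]
    exact Finset.single_le_sum (f := c) (fun i _ => h1 i) (Finset.mem_univ v)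

theorem vol_pyramid {n : ℕ} {ι : Type*} [Countable ι] [DecidableEq ι] {p : Fin n → ι → ℝ}
    {S : Finset (Fin n)} {σ : Finset ι} (hσ : ∀ i ∈ S, ∀ k, k ∉ σ → p i k = 0)
    {k0 : ι} (hk0 : k0 ∉ σ) {v : Fin n}
    (hv1 : p v k0 = 1) (hv : ∀ k, k ∉ insert k0 σ → p v k = 0) :
    MeasureTheory.volume (sec (insert k0 σ) (hullS p (insert v S)))
      = ENNReal.ofReal (1 / (σ.card + 1)) * MeasureTheory.volume (sec σ (hullS p S)) := by
  set Q := hullS p (insert v S) with hQ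
  have hQc : IsClosed Q := (isCompact_hullS p _).isClosed
  have hind : ∀ (τ : Finset ι) (x : ι → ℝ),
      MeasureTheory.lmarginal (fun _ : ι => (MeasureTheory.volume : MeasureTheory.Measure ℝ)) τ
        (Q.indicator 1) x
      = MeasureTheory.volume {y : τ → ℝ | Function.updateFinset x τ y ∈ Q} := by
    intro τ x
    have hm : MeasurableSet {y : τ → ℝ | Function.updateFinset x τ y ∈ Q} :=
      (hQc.preimage (continuous_ext0 x τ)).measurableSet
    rw [MeasureTheory.lmarginal, ← MeasureTheory.volume_pi, ← MeasureTheory.lintegral_indicator_one hm]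
    rfl
  have hmeas : Measurable (Q.indicator (1 : (ι → ℝ) → ENNReal)) := by
    exact measurable_one.indicator hQc.measurableSet
  rw [sec, ← hind, MeasureTheory.lmarginal_insert _ hmeas hk0]
  simp only [hind]
  have hae : ∀ᵐ h : ℝ, MeasureTheory.volume
      {y : σ → ℝ | Function.updateFinset (Function.update (0 : ι → ℝ) k0 h) σ y ∈ Q}
      = (Set.Ico (0 : ℝ) 1).indicator (fun h => ENNReal.ofReal ((1 - h) ^ σ.card) *
        MeasureTheory.volume (sec σ (hullS p S))) h := by
    filter_upwards [MeasureTheory.compl_mem_ae_iff.mpr (MeasureTheory.measure_singleton (1 : ℝ))]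
      with h hh
    have hh : h ≠ 1 := hh
    by_cases hI : h ∈ Set.Ico (0 : ℝ) 1
    · rw [Set.indicator_of_mem hI, (slice_eq hσ hk0 hv1 hv h).1 hI, MeasureTheory.measure_vadd,
        MeasureTheory.Measure.addHaar_smul_of_nonneg _ (by linarith [hI.2])]
      simp
    · rw [Set.indicator_of_notMem hI, (slice_eq hσ hk0 hv1 hv h).2, MeasureTheory.measure_empty]
      rintro ⟨h1, h2⟩
      exact hI ⟨h1, lt_of_le_of_ne h2 hh⟩
  rw [MeasureTheory.lintegral_congr_ae hae, MeasureTheory.lintegral_indicator measurableSet_Ico,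
    MeasureTheory.lintegral_mul_const, lintegral_pyr]
  fun_prop

/-- Normalized volume of a section. -/
def nvol {ι : Type*} [DecidableEq ι] (σ : Finset ι) (Q : Set (ι → ℝ)) : ℝ :=
  (σ.card.factorial : ℝ) * (MeasureTheory.volume (sec σ Q)).toReal

theorem nvol_pyramid {n : ℕ} {ι : Type*} [Countable ι] [DecidableEq ι] {p : Fin n → ι → ℝ}
    {S : Finset (Fin n)} {σ : Finset ι} (hσ : ∀ i ∈ S, ∀ k, k ∉ σ → p i k = 0)
    {k0 : ι} (hk0 : k0 ∉ σ) {v : Fin n}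
    (hv1 : p v k0 = 1) (hv : ∀ k, k ∉ insert k0 σ → p v k = 0) :
    nvol (insert k0 σ) (hullS p (insert v S)) = nvol σ (hullS p S) := by
  rw [nvol, nvol, vol_pyramid hσ hk0 hv1 hv, Finset.card_insert_of_notMem hk0, ENNReal.toReal_mul,
    ENNReal.toReal_ofReal (by positivity), Nat.factorial_succ]
  push_cast
  have : (σ.card : ℝ) + 1 ≠ 0 := by positivity
  field_simp

theorem nvol_eq_sum_cells {n : ℕ} {ι : Type*} [DecidableEq ι] {p : Fin n → ι → ℝ}
    (hnn : ∀ i k, 0 ≤ p i k) (σ : Finset ι) :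
    nvol σ (hullS p Finset.univ) = ∑ S ∈ cells p σ, nvol σ (hullS p S) := by
  simp only [nvol]
  rw [vol_eq_sum_cells hnn, ENNReal.toReal_sum, Finset.mul_sum]
  intro S _
  exact (isCompact_sec σ (isCompact_hullS p S)).measure_lt_top.ne


/-! ### The alternating sum -/

/-- The layers which contain at least two vertices of the cell. -/
def core {n : ℕ} {α β : Type*} [Fintype β] (p : Fin n → α ⊕ β → ℝ) (S : Finset (Fin n)) :
    Finset β :=
  Finset.univ.filter (fun j => 2 ≤ (S.filter (fun i => p i (Sum.inr j) = 1)).card)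

theorem mem_core {n : ℕ} {α β : Type*} [Fintype β] {p : Fin n → α ⊕ β → ℝ} {S : Finset (Fin n)}
    {j : β} : j ∈ core p S ↔ 2 ≤ (S.filter (fun i => p i (Sum.inr j) = 1)).card := by
  simp [core]

theorem core_insert {n : ℕ} {α β : Type*} [Fintype β] {p : Fin n → α ⊕ β → ℝ}
    (hdisj : ∀ i j j', p i (Sum.inr j) = 1 → p i (Sum.inr j') = 1 → j = j')
    {S : Finset (Fin n)} {v : Fin n} {j : β} (hv : p v (Sum.inr j) = 1)
    (hS : ∀ i ∈ S, p i (Sum.inr j) ≠ 1) : core p (insert v S) = core p S := by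
  ext j'
  rw [mem_core, mem_core, Finset.filter_insert]
  by_cases hj : j' = j
  · subst hj
    rw [if_pos hv, Finset.filter_false_of_mem hS]
    simp
  · rw [if_neg (fun h => hj (hdisj v j' j h hv))]

theorem insert_disjSum {α β : Type*} [DecidableEq α] [DecidableEq β] (I : Finset α) (J : Finset β)
    (j : β) : I.disjSum (insert j J) = insert (Sum.inr j) (I.disjSum J) := by
  ext k
  rcases k with k | k <;> simp

theorem filter_insert_layer {n : ℕ} {α β : Type*} {p : Fin n → α ⊕ β → ℝ}
    {S : Finset (Fin n)} {v : Fin n} {j : β} (hv : p v (Sum.inr j) = 1)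
    (hS : ∀ i ∈ S, p i (Sum.inr j) ≠ 1) :
    (insert v S).filter (fun i => p i (Sum.inr j) ≠ 1) = S := by
  rw [Finset.filter_insert, if_neg (by simpa using hv), Finset.filter_true_of_mem hS]

theorem cell_decomp {n : ℕ} {α β : Type*} [DecidableEq α] [DecidableEq β] [Fintype β]
    {p : Fin n → α ⊕ β → ℝ}
    (h01 : ∀ i j, p i (Sum.inr j) = 0 ∨ p i (Sum.inr j) = 1)
    (hdisj : ∀ i j j', p i (Sum.inr j) = 1 → p i (Sum.inr j') = 1 → j = j')
    {I : Finset α} {J : Finset β} {j : β} (hj : j ∉ J) {S : Finset (Fin n)}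
    (hS : S ∈ cells p (I.disjSum (insert j J))) (hcore : j ∉ core p S) :
    ∃ v S', S = insert v S' ∧ S.filter (fun i => p i (Sum.inr j) ≠ 1) = S' ∧ 
      p v (Sum.inr j) = 1 ∧
      (∀ k, k ∉ insert (Sum.inr j) (I.disjSum J) → p v k = 0) ∧ S' ∈ cells p (I.disjSum J) ∧
      core p S' = core p S := by
  have hjσ : Sum.inr j ∉ I.disjSum J := by simpa using hj
  rw [mem_cells, insert_disjSum, Finset.card_insert_of_notMem hjσ] at hS
  obtain ⟨hg, hf, hc⟩ := hS
  rw [mem_core] at hcore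
  have hface : ∀ i ∈ S.filter (fun i => p i (Sum.inr j) ≠ 1),
      ∀ k, k ∉ I.disjSum J → p i k = 0 := by
    intro i hi k hk
    rw [Finset.mem_filter] at hi
    by_cases hkj : k = Sum.inr j
    · subst hkj
      exact (h01 i j).resolve_right hi.2
    · exact hf i hi.1 k (by simp only [Finset.mem_insert, not_or]; exact ⟨hkj, hk⟩)
  have hg' : Good p (S.filter (fun i => p i (Sum.inr j) ≠ 1)) := hg.mono (Finset.filter_subset _ _)
  have hle := (good_card_le hg' hface).1
  have hsplit := Finset.card_filter_add_card_filter_not (s := S) (fun i => p i (Sum.inr j) = 1)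
  have hone : (S.filter (fun i => p i (Sum.inr j) = 1)).card = 1 := by
    simp only [ne_eq] at hle
    omega
  obtain ⟨v, hv⟩ := Finset.card_eq_one.1 hone
  have hvm : v ∈ S.filter (fun i => p i (Sum.inr j) = 1) := by rw [hv]; simp
  rw [Finset.mem_filter] at hvm
  have hSeq : S = insert v (S.filter (fun i => p i (Sum.inr j) ≠ 1)) := by
    conv_lhs => rw [← Finset.filter_union_filter_not_eq (fun i => p i (Sum.inr j) = 1) S, hv]
    rw [Finset.insert_eq]
  refine ⟨v, _, hSeq, rfl, hvm.2, fun k hk => hf v hvm.1 k hk, ?_, ?_⟩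
  · rw [mem_cells]
    refine ⟨hg', hface, ?_⟩
    simp only [ne_eq]
    omega
  · conv_rhs => rw [hSeq]
    exact (core_insert hdisj hvm.2 (fun i hi => (Finset.mem_filter.1 hi).2)).symm

/-- Contribution of the cells with given core. -/
def wt {n : ℕ} {α β : Type*} [DecidableEq α] [DecidableEq β] [Fintype β]
    (p : Fin n → α ⊕ β → ℝ) (I : Finset α) (A J : Finset β) : ℝ :=
  ∑ S ∈ (cells p (I.disjSum J)).filter (fun S => core p S = A), nvol (I.disjSum J) (hullS p S)

theorem wt_insert {n : ℕ} {α β : Type*} [DecidableEq α] [DecidableEq β] [Fintype α] [Fintype β]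
    {p : Fin n → α ⊕ β → ℝ}
    (hnn : ∀ i k, 0 ≤ p i k)
    (h01 : ∀ i j, p i (Sum.inr j) = 0 ∨ p i (Sum.inr j) = 1)
    (hdisj : ∀ i j j', p i (Sum.inr j) = 1 → p i (Sum.inr j') = 1 → j = j')
    (hbas : ∀ j, ∃ e, p e (Sum.inr j) = 1 ∧ ∀ k, k ≠ Sum.inr j → p e k = 0)
    (I : Finset α) (A J : Finset β) {j : β} (hjA : j ∉ A) (hj : j ∉ J) :
    wt p I A (insert j J) = wt p I A J := by
  have hjσ : Sum.inr j ∉ I.disjSum J := by simpa using hj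
  have hne1 : ∀ S ∈ cells p (I.disjSum J), ∀ i ∈ S, p i (Sum.inr j) ≠ 1 := by
    intro S hS i hi h
    have := (mem_cells.1 hS).2.1 i hi _ hjσ
    rw [h] at this
    norm_num at this
  unfold wt
  refine Finset.sum_bij (fun S _ => S.filter (fun i => p i (Sum.inr j) ≠ 1)) ?_ ?_ ?_ ?_
  · intro S hS
    rw [Finset.mem_filter] at hS
    obtain ⟨v, S', h1, h2, h3, h4, h5, h6⟩ := cell_decomp h01 hdisj hj hS.1 (by rw [hS.2]; exact hjA)
    rw [h2, Finset.mem_filter]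
    exact ⟨h5, h6.trans hS.2⟩
  · intro S hS T hT hST
    rw [Finset.mem_filter] at hS hT
    obtain ⟨v, S', h1, h2, h3, h4, h5, h6⟩ := cell_decomp h01 hdisj hj hS.1 (by rw [hS.2]; exact hjA)
    obtain ⟨v', S'', h1', h2', h3', h4', h5', h6'⟩ :=
      cell_decomp h01 hdisj hj hT.1 (by rw [hT.2]; exact hjA)
    have hEq : S' = S'' := by rw [← h2, ← h2']; exact hST
    subst hEq
    have hm := mem_cells.1 h5
    have hgS := (mem_cells.1 hS.1).1
    have hgT := (mem_cells.1 hT.1).1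
    rw [h1] at hgS
    rw [h1'] at hgT
    rw [h1, h1', good_extend_unique hm.1 hm.2.1 hm.2.2 hjσ h3 h4 h3' h4' hgS hgT]
  · intro S' hS'
    rw [Finset.mem_filter] at hS'
    have hm := mem_cells.1 hS'.1
    obtain ⟨e, he1, he⟩ := hbas j
    obtain ⟨v, hv1, hv, hg⟩ := good_extend hnn hm.1 hm.2.1 hm.2.2 hjσ (fun i => h01 i j) he1
      (fun k hk => he k (fun h => hk (by simp [h])))
    have hn := hne1 S' hS'.1
    have hvS : v ∉ S' := fun h => hn v h hv1
    refine ⟨insert v S', ?_, filter_insert_layer hv1 hn⟩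
    rw [Finset.mem_filter, mem_cells, insert_disjSum, Finset.card_insert_of_notMem hjσ,
      Finset.card_insert_of_notMem hvS, core_insert hdisj hv1 hn]
    refine ⟨⟨hg, ?_, by rw [hm.2.2]⟩, hS'.2⟩
    intro i hi k hk
    rcases Finset.mem_insert.1 hi with rfl | hi
    · exact hv k hk
    · exact hm.2.1 i hi k (fun h => hk (by simp only [Finset.mem_insert]; exact Or.inr h))
  · intro S hS
    rw [Finset.mem_filter] at hS
    obtain ⟨v, S', h1, h2, h3, h4, h5, h6⟩ := cell_decomp h01 hdisj hj hS.1 (by rw [hS.2]; exact hjA)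
    rw [h2, insert_disjSum, h1]
    exact nvol_pyramid (mem_cells.1 h5).2.1 hjσ h3 h4

theorem wt_univ {n : ℕ} {α β : Type*} [DecidableEq α] [DecidableEq β] [Fintype α] [Fintype β]
    {p : Fin n → α ⊕ β → ℝ}
    (hdisj : ∀ i j j', p i (Sum.inr j) = 1 → p i (Sum.inr j') = 1 → j = j')
    (hdim : ∀ u u' : β → Fin n, (∀ j, p (u j) (Sum.inr j) = 1) → (∀ j, p (u' j) (Sum.inr j) = 1) →
      ∃ μ : β → ℝ, μ ≠ 0 ∧ ∀ k, ∑ j, μ j * (p (u j) k - p (u' j) k) = 0)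
    (I : Finset α) (J : Finset β) : wt p I Finset.univ J = 0 := by
  unfold wt
  rw [Finset.filter_false_of_mem, Finset.sum_empty]
  intro S hS hcore
  have h2 : ∀ j, ∃ u u', u ∈ S ∧ u' ∈ S ∧ p u (Sum.inr j) = 1 ∧ p u' (Sum.inr j) = 1 ∧ u ≠ u' := by
    intro j
    have : j ∈ core p S := by rw [hcore]; simp
    rw [mem_core] at this
    obtain ⟨u, hu, u', hu', hne⟩ := Finset.one_lt_card.1 this
    rw [Finset.mem_filter] at hu hu'
    exact ⟨u, u', hu.1, hu'.1, hu.2, hu'.2, hne⟩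
  choose u u' huS huS' hu hu' hne using h2
  obtain ⟨μ, hμ, hsum⟩ := hdim u u' hu hu'
  set d : Fin n → ℝ := fun i =>
    ∑ j, μ j * ((if i = u j then 1 else 0) - (if i = u' j then 1 else 0)) with hd
  have hdf : ∀ f : Fin n → ℝ, ∑ i, d i * f i = ∑ j, μ j * (f (u j) - f (u' j)) := by
    intro f
    simp only [hd, Finset.sum_mul]
    rw [Finset.sum_comm]
    refine Finset.sum_congr rfl fun j _ => ?_
    simp only [mul_assoc, ← Finset.mul_sum, sub_mul, Finset.sum_sub_distrib]
    simp
  have hdep : Dep p d := by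
    refine ⟨?_, fun k => ?_⟩
    · have := hdf (fun _ => 1)
      simpa using this
    · rw [hdf (fun i => p i k)]
      exact hsum k
  have hd0 := (mem_cells.1 hS).1.indep hdep (by
    intro i hi
    refine Finset.sum_eq_zero fun j _ => ?_
    have e1 : i ≠ u j := fun h => hi (by rw [h]; exact huS j)
    have e2 : i ≠ u' j := fun h => hi (by rw [h]; exact huS' j)
    rw [if_neg e1, if_neg e2]
    simp)
  apply hμ
  ext j0
  have := congrFun hd0 (u j0)
  simp only [hd] at this
  rw [Finset.sum_eq_single j0] at this
  · simpa [hne j0] using this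
  · intro j _ hj
    rw [if_neg, if_neg]
    · simp
    · intro h
      exact hj (hdisj (u' j) j j0 (hu' j) (by rw [← h]; exact hu j0))
    · intro h
      exact hj (hdisj (u j) j j0 (hu j) (by rw [← h]; exact hu j0))
  · simp

theorem alt_sum_zero {n : ℕ} {α β : Type*} [DecidableEq α] [DecidableEq β] [Fintype α] [Fintype β]
    {p : Fin n → α ⊕ β → ℝ}
    (hnn : ∀ i k, 0 ≤ p i k)
    (h01 : ∀ i j, p i (Sum.inr j) = 0 ∨ p i (Sum.inr j) = 1)
    (hdisj : ∀ i j j', p i (Sum.inr j) = 1 → p i (Sum.inr j') = 1 → j = j')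
    (hbas : ∀ j, ∃ e, p e (Sum.inr j) = 1 ∧ ∀ k, k ≠ Sum.inr j → p e k = 0)
    (hdim : ∀ u u' : β → Fin n, (∀ j, p (u j) (Sum.inr j) = 1) → (∀ j, p (u' j) (Sum.inr j) = 1) →
      ∃ μ : β → ℝ, μ ≠ 0 ∧ ∀ k, ∑ j, μ j * (p (u j) k - p (u' j) k) = 0)
    (I : Finset α) :
    ∑ J : Finset β, (-1 : ℝ) ^ J.card * nvol (I.disjSum J) (hullS p Finset.univ) = 0 := by
  have h1 : ∀ J : Finset β, nvol (I.disjSum J) (hullS p Finset.univ)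
      = ∑ A : Finset β, wt p I A J := by
    intro J
    rw [nvol_eq_sum_cells hnn]
    unfold wt
    rw [Finset.sum_fiberwise]
  simp only [h1, Finset.mul_sum]
  rw [Finset.sum_comm]
  refine Finset.sum_eq_zero fun A _ => ?_
  by_cases hA : A = Finset.univ
  · subst hA
    exact Finset.sum_eq_zero fun J _ => by rw [wt_univ hdisj hdim, mul_zero]
  · obtain ⟨j, hj⟩ : ∃ j, j ∉ A := by
      by_contra hc
      push Not at hc
      exact hA (Finset.eq_univ_iff_forall.2 hc)
    rw [← Finset.powerset_univ, ← Finset.insert_erase (Finset.mem_univ j),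
      Finset.sum_powerset_insert (Finset.notMem_erase j _), ← Finset.sum_add_distrib]
    refine Finset.sum_eq_zero fun J hJ => ?_
    have hjJ : j ∉ J := fun h => Finset.notMem_erase j _ (Finset.mem_powerset.1 hJ h)
    rw [Finset.card_insert_of_notMem hjJ, wt_insert hnn h01 hdisj hbas I A J hj hjJ, pow_succ]
    ring


theorem latVol_eq_nvol {a b : ℕ} (σ : Finset (Fin a ⊕ Fin b)) {Q : Set (Fin a ⊕ Fin b → ℝ)}
    (hQ : IsCompact Q) (hconv : Convex ℝ Q) :
    latVol (intLatticeProd a b) σ.card ({x | Sum.elim x.1 x.2 ∈ Q} ∩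
      {x | ∀ idx, idx ∉ σ → coordP a b idx x = 0}) = nvol σ Q := by
  have hcomp := isCompact_sec σ hQ
  have hYconv : Convex ℝ (sec σ Q) := by
    intro x hx y hy s t hs ht hst
    have := hconv hx hy hs ht hst
    have h2 : Function.updateFinset (0 : Fin a ⊕ Fin b → ℝ) σ (s • x + t • y)
        = s • Function.updateFinset (0 : Fin a ⊕ Fin b → ℝ) σ x
          + t • Function.updateFinset (0 : Fin a ⊕ Fin b → ℝ) σ y := by
      ext k
      by_cases hk : k ∈ σ <;> simp [Function.updateFinset, hk]
    change Function.updateFinset (0 : Fin a ⊕ Fin b → ℝ) σ (s • x + t • y) ∈ Q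
    rw [h2]
    exact this
  have ht := tendsto_card_div_pow_atTop_volume (sec σ Q) hcomp.isBounded
    hcomp.isClosed.measurableSet (hYconv.addHaar_frontier _)
  have hcard : ∀ t : ℕ, t ≠ 0 → Nat.card ↥(((t : ℝ) • ({x | Sum.elim x.1 x.2 ∈ Q} ∩
      {x | ∀ idx, idx ∉ σ → coordP a b idx x = 0})) ∩
        (intLatticeProd a b : Set ((Fin a → ℝ) × (Fin b → ℝ)))) =
      Nat.card ↑(sec σ Q ∩ (t : ℝ)⁻¹ •
        (Submodule.span ℤ (Set.range (Pi.basisFun ℝ σ)) : Set (σ → ℝ))) := by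
    intro t ht0
    have ht0' : (t : ℝ) ≠ 0 := by exact_mod_cast ht0
    have hL : ∀ z : σ → ℝ, z ∈ (Submodule.span ℤ (Set.range (Pi.basisFun ℝ σ)) : Set (σ → ℝ)) ↔
        ∀ k, ∃ m : ℤ, z k = m := by
      intro z
      rw [SetLike.mem_coe, Module.Basis.mem_span_iff_repr_mem]
      simp [eq_comm]
    -- the coordinate map
    let f : (Fin a → ℝ) × (Fin b → ℝ) → σ → ℝ := fun x k => (t : ℝ)⁻¹ * coordP a b k x
    have hx0 : ∀ x ∈ (t : ℝ) • ({x | Sum.elim x.1 x.2 ∈ Q} ∩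
        {x : (Fin a → ℝ) × (Fin b → ℝ) | ∀ idx, idx ∉ σ → coordP a b idx x = 0}),
        (∀ idx, idx ∉ σ → coordP a b idx x = 0) ∧ f x ∈ sec σ Q := by
      rintro _ ⟨x, ⟨hx1, hx2⟩, rfl⟩
      have hsm : ∀ idx, coordP a b idx ((t : ℝ) • x) = t * coordP a b idx x := by
        rintro (i | j) <;> simp [coordP]
      refine ⟨fun idx hidx => ?_, ?_⟩
      · show coordP a b idx ((t : ℝ) • x) = 0
        rw [hsm, hx2 idx hidx, mul_zero]
      · show Function.updateFinset (0 : Fin a ⊕ Fin b → ℝ) σ _ ∈ Q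
        have hx1 : Sum.elim x.1 x.2 ∈ Q := hx1
        convert hx1 using 1
        ext k
        by_cases hk : k ∈ σ
        · simp only [Function.updateFinset, hk, dif_pos, f]
          rw [hsm, ← mul_assoc, inv_mul_cancel₀ ht0', one_mul]
          rcases k with k | k <;> rfl
        · simp only [Function.updateFinset, hk, dif_neg, not_false_eq_true, Pi.zero_apply]
          have := hx2 k hk
          rw [← this]
          rcases k with k | k <;> rfl
    have hinj : Set.InjOn f (((t : ℝ) • ({x | Sum.elim x.1 x.2 ∈ Q} ∩
      {x | ∀ idx, idx ∉ σ → coordP a b idx x = 0})) ∩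
        (intLatticeProd a b : Set ((Fin a → ℝ) × (Fin b → ℝ)))) := by
      rintro x ⟨hx, -⟩ y ⟨hy, -⟩ hxy
      have hall : ∀ idx, coordP a b idx x = coordP a b idx y := by
        intro idx
        by_cases h : idx ∈ σ
        · have := congrFun hxy ⟨idx, h⟩
          exact mul_left_cancel₀ (inv_ne_zero ht0') this
        · rw [(hx0 x hx).1 idx h, (hx0 y hy).1 idx h]
      ext i
      · exact hall (Sum.inl i)
      · exact hall (Sum.inr i)
    rw [Nat.card_coe_set_eq, Nat.card_coe_set_eq, ← Set.ncard_image_of_injOn hinj]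
    congr 1
    ext y
    constructor
    · rintro ⟨x, ⟨hx, hxL⟩, rfl⟩
      refine ⟨(hx0 x hx).2, fun k => coordP a b k x, ?_, ?_⟩
      · rw [hL]
        rintro ⟨k | k, hk⟩
        · exact hxL.1 k
        · exact hxL.2 k
      · ext k; simp [f]
    · rintro ⟨hy, z, hz, rfl⟩
      rw [hL] at hz
      set x : Fin a ⊕ Fin b → ℝ := Function.updateFinset (0 : Fin a ⊕ Fin b → ℝ) σ
        ((t : ℝ)⁻¹ • z) with hx
      have hxQ : x ∈ Q := hy
      have hco : ∀ idx, coordP a b idx ((t : ℝ) • ((fun i => x (Sum.inl i), fun j => x (Sum.inr j)) :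
          (Fin a → ℝ) × (Fin b → ℝ))) = t * x idx := by
        rintro (i | j) <;> simp [coordP]
      have hxz : ∀ k : σ, (t : ℝ) * x k = z k := by
        intro k
        simp [hx, Function.updateFinset, ht0']
      have hxn : ∀ k, k ∉ σ → x k = 0 := by
        intro k hk
        simp [hx, Function.updateFinset, hk]
      have hintg : ∀ k, ∃ m : ℤ, (t : ℝ) * x k = m := by
        intro k
        by_cases hk : k ∈ σ
        · rw [hxz ⟨k, hk⟩]; exact hz _
        · exact ⟨0, by simp [hxn k hk]⟩
      refine ⟨(t : ℝ) • ((fun i => x (Sum.inl i), fun j => x (Sum.inr j)) :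
          (Fin a → ℝ) × (Fin b → ℝ)), ⟨⟨_, ⟨?_, ?_⟩, rfl⟩, ?_⟩, ?_⟩
      · show Sum.elim _ _ ∈ Q
        convert hxQ using 1
        ext k
        rcases k with k | k <;> rfl
      · intro idx hidx
        rcases idx with k | k
        · exact hxn _ hidx
        · exact hxn _ hidx
      · exact ⟨fun i => by simpa using hintg (Sum.inl i), fun j => by simpa using hintg (Sum.inr j)⟩
      · ext k
        simp only [f, hco, hxz]
        simp
  unfold latVol
  apply Filter.Tendsto.limsup_eq
  have ht2 := ht.const_mul (σ.card.factorial : ℝ)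
  rw [nvol]
  refine ht2.congr' ?_
  filter_upwards [Filter.eventually_ne_atTop 0] with t ht0
  rw [hcard t ht0, mul_div_assoc, Fintype.card_coe]


/-! ### Assembling -/

theorem convex_hullS {n : ℕ} {ι : Type*} (p : Fin n → ι → ℝ) (S : Finset (Fin n)) :
    Convex ℝ (hullS p S) := by
  rintro x ⟨c, hc0, hcS, hc1, hcx⟩ y ⟨d, hd0, hdS, hd1, hdy⟩ s t hs ht hst
  refine ⟨fun i => s * c i + t * d i, fun i => ?_, fun i hi => ?_, ?_, fun k => ?_⟩
  · have := hc0 i; have := hd0 i; positivity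
  · simp [hcS i hi, hdS i hi]
  · rw [Finset.sum_add_distrib, ← Finset.mul_sum, ← Finset.mul_sum, hc1, hd1]; linarith
  · simp only [Pi.add_apply, Pi.smul_apply, smul_eq_mul, ← hcx k, ← hdy k, Finset.mul_sum,
      ← Finset.sum_add_distrib]
    exact Finset.sum_congr rfl fun i _ => by ring

theorem mem_hullS_self {n : ℕ} {ι : Type*} (p : Fin n → ι → ℝ) (i : Fin n) :
    p i ∈ hullS p Finset.univ := by
  refine ⟨fun j => if j = i then 1 else 0, fun j => ?_, fun j hj => ?_, ?_, fun k => ?_⟩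
  · dsimp only; split_ifs <;> norm_num
  · simp at hj
  · simp
  · simp

theorem cayley_eq {a b n : ℕ} (Pi : Fin (b + 1) → Set (Fin a → ℝ))
    (F : Fin (b + 1) → Finset (Fin a → ℝ))
    (hF : ∀ i, Pi i = convexHull ℝ (F i : Set (Fin a → ℝ)))
    (x : Fin n → Fin a → ℝ) (l : Fin n → Fin (b + 1)) (hx : ∀ i, x i ∈ Pi (l i))
    (hsurj : ∀ i, ∀ y ∈ F i, ∃ m, x m = y ∧ l m = i) :
    convexHull ℝ (⋃ i : Fin (b + 1), (Pi i) ×ˢ ({eVec b i} : Set (Fin b → ℝ)))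
      = {z : (Fin a → ℝ) × (Fin b → ℝ) | Sum.elim z.1 z.2 ∈
          hullS (fun i => Sum.elim (x i) (eVec b (l i))) Finset.univ} := by
  set p : Fin n → (Fin a ⊕ Fin b → ℝ) := fun i => Sum.elim (x i) (eVec b (l i)) with hp
  apply Set.Subset.antisymm
  · apply convexHull_min
    · intro z hz
      simp only [Set.mem_iUnion, Set.mem_prod, Set.mem_singleton_iff] at hz
      obtain ⟨i, hz1, hz2⟩ := hz
      rw [hF i] at hz1
      have hsub : convexHull ℝ (F i : Set (Fin a → ℝ)) ⊆
          {y : Fin a → ℝ | Sum.elim y (eVec b i) ∈ hullS p Finset.univ} := by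
        apply convexHull_min
        · intro y hy
          obtain ⟨m, rfl, rfl⟩ := hsurj i y hy
          exact mem_hullS_self p m
        · intro y hy y' hy' s t hs ht hst
          have := convex_hullS p Finset.univ hy hy' hs ht hst
          have h2 : Sum.elim (s • y + t • y') (eVec b i)
              = s • Sum.elim y (eVec b i) + t • Sum.elim y' (eVec b i) := by
            ext k
            rcases k with k | k
            · simp
            · simp [← add_mul, hst]
          show Sum.elim (s • y + t • y') (eVec b i) ∈ hullS p Finset.univ
          rw [h2]; exact this
      have := hsub hz1
      simp only [Set.mem_ofPred_eq, hz2] at this ⊢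
      exact this
    · intro y hy y' hy' s t hs ht hst
      have := convex_hullS p Finset.univ hy hy' hs ht hst
      have h2 : Sum.elim (s • y + t • y').1 (s • y + t • y').2
          = s • Sum.elim y.1 y.2 + t • Sum.elim y'.1 y'.2 := by
        ext k
        rcases k with k | k <;> simp
      show Sum.elim (s • y + t • y').1 (s • y + t • y').2 ∈ hullS p Finset.univ
      rw [h2]; exact this
  · rintro z ⟨c, hc0, -, hc1, hcz⟩
    have hz : z = ∑ i, c i • ((x i, eVec b (l i)) : (Fin a → ℝ) × (Fin b → ℝ)) := by
      ext k
      · rw [Prod.fst_sum, Finset.sum_apply]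
        simpa [hp] using (hcz (Sum.inl k)).symm
      · rw [Prod.snd_sum, Finset.sum_apply]
        simpa [hp] using (hcz (Sum.inr k)).symm
    rw [hz]
    refine (convex_convexHull ℝ _).sum_mem (fun i _ => hc0 i) hc1 fun i _ => ?_
    apply subset_convexHull
    simp only [Set.mem_iUnion, Set.mem_prod, Set.mem_singleton_iff]
    exact ⟨l i, hx i, rfl⟩

theorem newton_of_hull {a b : ℕ} {Q : Set (Fin a ⊕ Fin b → ℝ)} (hQ : IsCompact Q)
    (hconv : Convex ℝ Q)
    (h : ∀ I : Finset (Fin a), ∑ J : Finset (Fin b), (-1 : ℝ) ^ J.card * nvol (I.disjSum J) Q = 0) :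
    newtonNumber a b {z | Sum.elim z.1 z.2 ∈ Q} = 0 := by
  unfold newtonNumber
  rw [Finset.powerset_univ, ← Finset.sumEquiv.symm.toEquiv.sum_comp, Fintype.sum_prod_type]
  apply Finset.sum_eq_zero
  intro I _
  have key : ∀ J : Finset (Fin b), (-1 : ℝ) ^ (a + b - (I.disjSum J).card)
      = (-1) ^ (a + b) * (-1) ^ I.card * (-1) ^ J.card := by
    intro J
    have h1 : I.card ≤ a := by simpa using I.card_le_univ
    have h2 : J.card ≤ b := by simpa using J.card_le_univ
    rw [Finset.card_disjSum]
    obtain ⟨m, hm⟩ : ∃ m, a + b = m + (I.card + J.card) := ⟨a + b - (I.card + J.card), by omega⟩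
    rw [hm, Nat.add_sub_cancel, mul_assoc, ← pow_add, pow_add _ m, mul_assoc, ← mul_pow]
    simp
  have h3 := h I
  refine Eq.trans ?_ (mul_eq_zero_of_right ((-1 : ℝ) ^ (a + b) * (-1) ^ I.card) h3)
  rw [Finset.mul_sum]
  refine Finset.sum_congr rfl fun J _ => ?_
  show (-1 : ℝ) ^ (a + b - (I.disjSum J).card) * latVol (intLatticeProd a b) (I.disjSum J).card
    ({x | Sum.elim x.1 x.2 ∈ Q} ∩ {x | ∀ idx, idx ∉ I.disjSum J → coordP a b idx x = 0}) = _
  rw [latVol_eq_nvol _ hQ hconv, key, mul_assoc _ _ (nvol _ _)]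

theorem eVec_eq_one {b : ℕ} {i : Fin (b + 1)} {j : Fin b} (h : eVec b i j = 1) : i = j.succ := by
  unfold eVec at h
  split_ifs at h with h1
  · ext; simpa using h1
  · norm_num at h

theorem dep_of_finrank {a b : ℕ} (Pi : Fin (b + 1) → Set (Fin a → ℝ))
    (hdimsum : Module.finrank ℝ (vectorSpan ℝ (∑ i : Fin b, Pi i.succ)) < b)
    (hz : ∀ j : Fin b, (0 : Fin a → ℝ) ∈ Pi j.succ) (y y' : Fin b → Fin a → ℝ)
    (hy : ∀ j, y j ∈ Pi j.succ) (hy' : ∀ j, y' j ∈ Pi j.succ) :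
    ∃ μ : Fin b → ℝ, μ ≠ 0 ∧ ∑ j, μ j • (y j - y' j) = 0 := by
  have hin : ∀ (j : Fin b) (w : Fin a → ℝ), w ∈ Pi j.succ → w ∈ ∑ i : Fin b, Pi i.succ := by
    intro j w hw
    rw [Set.mem_fintype_sum]
    refine ⟨fun i => if i = j then w else 0, fun i => ?_, by simp⟩
    dsimp only
    split_ifs with h
    · rw [h]; exact hw
    · exact hz i
  have hmem : ∀ j, y j - y' j ∈ vectorSpan ℝ (∑ i : Fin b, Pi i.succ) := fun j =>
    vsub_mem_vectorSpan ℝ (hin j _ (hy j)) (hin j _ (hy' j))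
  set W := vectorSpan ℝ (∑ i : Fin b, Pi i.succ)
  have hnot : ¬ LinearIndependent ℝ (fun j : Fin b => (⟨y j - y' j, hmem j⟩ : W)) := by
    intro hli
    have := hli.fintype_card_le_finrank
    simp at this
    omega
  rw [Fintype.not_linearIndependent_iff] at hnot
  obtain ⟨g, hg, i, hi⟩ := hnot
  refine ⟨g, fun h => hi (by rw [h]; rfl), ?_⟩
  have := congrArg (Subtype.val) hg
  simpa using this


/-- **`B_k`-polytopes are negligible.**
Let `P = P₀ ∗ P₁ ∗ ⋯ ∗ P_k ⊆ ℝ^{n−k} ⊕ ℝ^k_{≥0}` be a Cayley sum of lattice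
polytopes with `dim (P₁ + ⋯ + P_k) < k` and `dim P₀ = n − k` (a `B_k`-polytope,
here `a = n − k`, `b = k`) which is convenient in `ℝⁿ_{≥0}`. Then its Newton
number vanishes: `ν(P) = 0`. -/
theorem Bk_polytope_negligible (a b : ℕ)
    (Pi : Fin (b + 1) → Set (Fin a → ℝ))
    (hpoly : ∀ i, ∃ F : Finset (Fin a → ℝ),
      (∀ p ∈ F, ∀ j, ∃ m : ℤ, p j = (m : ℝ)) ∧ Pi i = convexHull ℝ (F : Set (Fin a → ℝ)))
    (hdimsum : Module.finrank ℝ (vectorSpan ℝ (∑ i : Fin b, Pi i.succ)) < b)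
    (hdim0 : Module.finrank ℝ (vectorSpan ℝ (Pi 0)) = a)
    (CP : Set ((Fin a → ℝ) × (Fin b → ℝ)))
    (hCP : CP = convexHull ℝ (⋃ i : Fin (b + 1), (Pi i) ×ˢ ({eVec b i} : Set (Fin b → ℝ))))
    (hnonneg : ∀ x ∈ CP, (∀ i, 0 ≤ x.1 i) ∧ (∀ j, 0 ≤ x.2 j))
    (h0 : ((0 : Fin a → ℝ), (0 : Fin b → ℝ)) ∈ CP)
    (hbasis1 : ∀ i : Fin a, ((fun j => if j = i then (1 : ℝ) else 0), (0 : Fin b → ℝ)) ∈ CP)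
    (hbasis2 : ∀ j : Fin b, ((0 : Fin a → ℝ), (fun j' => if j' = j then (1 : ℝ) else 0)) ∈ CP) :
    newtonNumber a b CP = 0 := by

  choose F hFint hF using hpoly
  let κ := Σ i : Fin (b + 1), F i
  let e : Fin (Fintype.card κ) ≃ κ := (Fintype.equivFin κ).symm
  let x : Fin (Fintype.card κ) → Fin a → ℝ := fun m => ((e m).2 : Fin a → ℝ)
  let l : Fin (Fintype.card κ) → Fin (b + 1) := fun m => (e m).1
  have hx : ∀ i, x i ∈ Pi (l i) := fun i => by
    rw [hF]; exact subset_convexHull ℝ _ (e i).2.2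
  have hsurj : ∀ i, ∀ y ∈ F i, ∃ m, x m = y ∧ l m = i := fun i y hy =>
    ⟨e.symm ⟨i, y, hy⟩, by simp only [x]; rw [Equiv.apply_symm_apply], by simp [l]⟩
  rw [cayley_eq Pi F hF x l hx hsurj] at hCP
  clear_value x l
  set p : Fin (Fintype.card κ) → (Fin a ⊕ Fin b → ℝ) :=
    fun i => Sum.elim (x i) (eVec b (l i)) with hp
  have hnn : ∀ i k, 0 ≤ p i k := by
    intro i k
    have := hnonneg (x i, eVec b (l i)) (by rw [hCP]; exact mem_hullS_self p i)
    rcases k with k | k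
    · exact this.1 k
    · exact this.2 k
  have hone : ∀ i j, p i (Sum.inr j) = 1 → l i = j.succ := fun i j h => eVec_eq_one h
  have h01 : ∀ i j, p i (Sum.inr j) = 0 ∨ p i (Sum.inr j) = 1 := by
    intro i j
    simp only [hp, Sum.elim_inr, eVec]
    split_ifs <;> simp
  have hdisj : ∀ i j j', p i (Sum.inr j) = 1 → p i (Sum.inr j') = 1 → j = j' := by
    intro i j j' h h'
    exact Fin.succ_injective _ ((hone i j h).symm.trans (hone i j' h'))
  have hbas : ∀ j : Fin b, ∃ e, p e (Sum.inr j) = 1 ∧ ∀ k, k ≠ Sum.inr j → p e k = 0 := by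
    intro j
    have hj := hbasis2 j
    rw [hCP] at hj
    obtain ⟨c, hc0, -, hc1, hck⟩ := hj
    have hpos : ∃ i, c i * p i (Sum.inr j) ≠ 0 := by
      by_contra hcon
      push Not at hcon
      have := hck (Sum.inr j)
      rw [Finset.sum_eq_zero (fun i _ => hcon i)] at this
      simp at this
    obtain ⟨i, hi⟩ := hpos
    have hci : c i ≠ 0 := left_ne_zero_of_mul hi
    refine ⟨i, (h01 i j).resolve_left (right_ne_zero_of_mul hi), fun k hk => ?_⟩
    have hs : ∑ i, c i * p i k = 0 := by
      rw [hck k]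
      rcases k with k | k
      · rfl
      · have : k ≠ j := fun h => hk (by rw [h])
        simp [this]
    have := (Finset.sum_eq_zero_iff_of_nonneg
      (fun i _ => mul_nonneg (hc0 i) (hnn i k))).1 hs i (Finset.mem_univ i)
    exact (mul_eq_zero.1 this).resolve_left hci
  have hz : ∀ j : Fin b, (0 : Fin a → ℝ) ∈ Pi j.succ := by
    intro j
    obtain ⟨i, hi1, hi2⟩ := hbas j
    have h1 : x i = 0 := by
      ext k
      exact hi2 (Sum.inl k) (by simp)
    rw [← h1, ← hone i j hi1]
    exact hx i
  have hdim : ∀ u u' : Fin b → Fin (Fintype.card κ), (∀ j, p (u j) (Sum.inr j) = 1) →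
      (∀ j, p (u' j) (Sum.inr j) = 1) →
      ∃ μ : Fin b → ℝ, μ ≠ 0 ∧ ∀ k, ∑ j, μ j * (p (u j) k - p (u' j) k) = 0 := by
    intro u u' hu hu'
    obtain ⟨μ, hμ, hsum⟩ := dep_of_finrank Pi hdimsum hz (fun j => x (u j)) (fun j => x (u' j))
      (fun j => hone _ _ (hu j) ▸ hx (u j)) (fun j => hone _ _ (hu' j) ▸ hx (u' j))
    refine ⟨μ, hμ, fun k => ?_⟩
    rcases k with k | k
    · have := congrFun hsum k
      simpa [hp] using this
    · apply Finset.sum_eq_zero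
      intro j _
      simp [hp, hone _ _ (hu j), hone _ _ (hu' j)]
  rw [hCP]
  exact newton_of_hull (isCompact_hullS p _) (convex_hullS p _)
    (fun I => alt_sum_zero hnn h01 hdisj hbas hdim I)

end
end

section
/- Let 𝐏 = 𝐏_0 ∗_{a_1} 𝐏_1 ∗_{a_2} ⋯ ∗_{a_k} 𝐏_k ⊂ ℤ^{n−k} ⊕ ℤ^k_{≥0} be a stretched B_k-set, i.e. 𝐏_0, …, 𝐏_k ⊂ ℤ^{n−k} are finite lattice sets with dim(𝐏_1 + ⋯ + 𝐏_k) < k and dim(𝐏_0) = n − k, and a_1, …, a_k are positive integers. If 𝐏 lies in ℝ^n_{≥0} and the off-coordinate polytopes of 𝐏 are nonempty, then Voff_{ℝ^n_{≥0}}(𝐏) = 0. -/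
open Pointwise MeasureTheory
open scoped Classical

noncomputable section

/-- Lattice-normalized volume on `ℝᵃ × ℝᵇ ≅ ℝⁿ` (`n = a + b`): `n!` times the
Lebesgue volume, so that a unit lattice simplex has volume `1`. -/
def latVolP (a b : ℕ) (Q : Set ((Fin a → ℝ) × (Fin b → ℝ))) : ℝ :=
  (Nat.factorial (a + b) : ℝ) * (volume Q).toReal

/-- Mixed volume of `n = a + b` polytopes in `ℝᵃ × ℝᵇ ≅ ℝⁿ`, via
inclusion–exclusion of lattice volumes of Minkowski sums. -/
def mixedVolP (a b : ℕ) (Q : Fin a ⊕ Fin b → Set ((Fin a → ℝ) × (Fin b → ℝ))) : ℝ :=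
  ∑ I ∈ (Finset.univ : Finset (Fin a ⊕ Fin b)).powerset,
    if I.Nonempty then (-1 : ℝ) ^ (a + b - I.card) * latVolP a b (∑ i ∈ I, Q i) else 0

namespace VoffAux

section Abstract

variable {E : Type*} [NormedAddCommGroup E] [NormedSpace ℝ E]
variable {ι : Type*}

/-- The set of maximizers of the tilted functional `u - w i` on `A i`. -/
def face (A : ι → Finset E) (w : ι → E → ℝ) (i : ι) (u : StrongDual ℝ E) : Finset E :=
  (A i).filter (fun v => ∀ v' ∈ A i, u v' - w i v' ≤ u v - w i v)

/-- The tilted support function of `A i`. -/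
def supp (A : ι → Finset E) (hA : ∀ i, (A i).Nonempty) (w : ι → E → ℝ) (i : ι)
    (u : StrongDual ℝ E) : ℝ :=
  (A i).sup' (hA i) (fun v => u v - w i v)

/-- Minkowski sum of convex hulls. -/
def msum (F : ι → Finset E) (I : Finset ι) : Set E :=
  ∑ i ∈ I, convexHull ℝ (F i : Set E)

variable (A : ι → Finset E) (hA : ∀ i, (A i).Nonempty) (w : ι → E → ℝ)

lemma le_supp (i : ι) (u : StrongDual ℝ E) {v : E} (hv : v ∈ A i) :
    u v - w i v ≤ supp A hA w i u :=
  Finset.le_sup' (fun v => u v - w i v) hv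

lemma face_eq (i : ι) (u : StrongDual ℝ E) {v : E} (hv : v ∈ face A w i u) :
    u v - w i v = supp A hA w i u := by
  unfold face at hv
  rw [Finset.mem_filter] at hv
  apply le_antisymm (le_supp A hA w i u hv.1)
  exact Finset.sup'_le _ _ hv.2

lemma mem_face (i : ι) (u : StrongDual ℝ E) {v : E} (hv : v ∈ A i)
    (h : supp A hA w i u ≤ u v - w i v) : v ∈ face A w i u := by
  unfold face
  rw [Finset.mem_filter]
  exact ⟨hv, fun v' hv' => (le_supp A hA w i u hv').trans h⟩

lemma face_subset (i : ι) (u : StrongDual ℝ E) : face A w i u ⊆ A i :=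
  Finset.filter_subset _ _

include hA in
lemma face_nonempty (i : ι) (u : StrongDual ℝ E) : (face A w i u).Nonempty := by
  obtain ⟨v, hv, h⟩ := Finset.exists_mem_eq_sup' (hA i) (fun v => u v - w i v)
  exact ⟨v, mem_face A hA w i u hv (le_of_eq h)⟩

lemma supp_continuous (i : ι) : Continuous (supp A hA w i) := by
  unfold supp
  apply Continuous.finset_sup'_apply
  intro v _
  fun_prop

lemma msum_convex (F : ι → Finset E) (I : Finset ι) : Convex ℝ (msum F I) :=
  convex_sum _ (fun _ _ => convex_convexHull ℝ _)

lemma msum_compact (F : ι → Finset E) (I : Finset ι) : IsCompact (msum F I) := by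
  unfold msum
  rw [← convexHull_sum]
  apply Set.Finite.isCompact_convexHull
  induction I using Finset.induction_on with
  | empty => simp
  | insert i s hi ih =>
    rw [Finset.sum_insert hi]
    exact (Finset.finite_toSet _).add ih

lemma msum_mono (F F' : ι → Finset E) (h : ∀ i, F i ⊆ F' i) (I : Finset ι) :
    msum F I ⊆ msum F' I := by
  intro z hz
  unfold msum at hz ⊢
  rw [Set.mem_finsetSum] at hz ⊢
  obtain ⟨g, hg, rfl⟩ := hz
  exact ⟨g, fun hi => convexHull_mono (by exact_mod_cast h _) (hg hi), rfl⟩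

/-- points of a cell are subgradients -/
lemma subgrad (I : Finset ι) (u u' : StrongDual ℝ E) {z : E}
    (hz : z ∈ msum (fun i => face A w i u) I) :
    (u' - u) z ≤ ∑ i ∈ I, supp A hA w i u' - ∑ i ∈ I, supp A hA w i u := by
  unfold msum at hz
  rw [Set.mem_finsetSum] at hz
  obtain ⟨g, hg, rfl⟩ := hz
  rw [map_sum, ← Finset.sum_sub_distrib]
  apply Finset.sum_le_sum
  intro i hi
  have hc : Convex ℝ {x : E | (u' - u) x ≤ supp A hA w i u' - supp A hA w i u} :=
    convex_halfSpace_le (u' - u).isLinear _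
  have hsub : (face A w i u : Set E) ⊆ {x : E | (u' - u) x ≤ supp A hA w i u' - supp A hA w i u} := by
    intro v hv
    have hv : v ∈ face A w i u := hv
    have h1 := face_eq A hA w i u hv
    have h2 := le_supp A hA w i u' (face_subset A w i u hv)
    simp only [Set.mem_setOf_eq, ContinuousLinearMap.sub_apply]
    linarith
  exact convexHull_min hsub hc (hg hi)

lemma upper_bound (I : Finset ι) (u : StrongDual ℝ E) {z : E} (hz : z ∈ msum A I) :
    u z ≤ ∑ i ∈ I, supp A hA w i u + ∑ i ∈ I, ∑ v ∈ A i, |w i v| := by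
  unfold msum at hz
  rw [Set.mem_finsetSum] at hz
  obtain ⟨g, hg, rfl⟩ := hz
  rw [map_sum, ← Finset.sum_add_distrib]
  apply Finset.sum_le_sum
  intro i hi
  have hc : Convex ℝ {x : E | u x ≤ supp A hA w i u + ∑ v ∈ A i, |w i v|} :=
    convex_halfSpace_le u.isLinear _
  refine convexHull_min ?_ hc (hg hi)
  intro v hv
  have hv : v ∈ A i := hv
  have h1 := le_supp A hA w i u hv
  have h2 : |w i v| ≤ ∑ v ∈ A i, |w i v| :=
    Finset.single_le_sum (f := fun v => |w i v|) (fun _ _ => abs_nonneg _) hv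
  have h3 := le_abs_self (w i v)
  simp only [Set.mem_setOf_eq]
  linarith

/-- a minimizer of `G - z` has `z` in its cell -/
lemma mem_cell_of_min (I : Finset ι) (u : StrongDual ℝ E) (z : E)
    (hmin : ∀ u' : StrongDual ℝ E, ∑ i ∈ I, supp A hA w i u - u z ≤
      ∑ i ∈ I, supp A hA w i u' - u' z) :
    z ∈ msum (fun i => face A w i u) I := by
  by_contra hz
  obtain ⟨f, s, hs, hsz⟩ := geometric_hahn_banach_closed_point (msum_convex _ I)
    (msum_compact (fun i => face A w i u) I).isClosed hz
  have hev : ∀ᶠ ε : ℝ in nhdsWithin 0 (Set.Ioi 0), ∀ i ∈ I, ∀ v ∈ A i, v ∉ face A w i u →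
      (u + ε • f) v - w i v < supp A hA w i (u + ε • f) := by
    apply Filter.Eventually.filter_mono nhdsWithin_le_nhds
    rw [Filter.eventually_all_finset]
    intro i hi
    rw [Filter.eventually_all_finset]
    intro v hv
    rw [Filter.eventually_imp_distrib_left]
    intro hvF
    have hlt : u v - w i v < supp A hA w i u := by
      by_contra hcon
      exact hvF (mem_face A hA w i u hv (not_lt.mp hcon))
    have c1 : Continuous (fun ε : ℝ => (u + ε • f) v - w i v) := by
      simp only [ContinuousLinearMap.add_apply, ContinuousLinearMap.smul_apply]
      fun_prop
    have c2 : Continuous (fun ε : ℝ => supp A hA w i (u + ε • f)) :=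
      (supp_continuous A hA w i).comp (by fun_prop)
    apply Filter.Tendsto.eventually_lt c1.continuousAt c2.continuousAt
    simpa using hlt
  obtain ⟨ε, hε, hεpos⟩ := (hev.and self_mem_nhdsWithin).exists
  have hεpos : 0 < ε := hεpos
  have hch : ∀ i, ∃ v ∈ A i, supp A hA w i (u + ε • f) = (u + ε • f) v - w i v := fun i =>
    Finset.exists_mem_eq_sup' (hA i) (fun v => (u + ε • f) v - w i v)
  choose v hv hveq using hch
  have hvF : ∀ i ∈ I, v i ∈ face A w i u := by
    intro i hi
    by_contra hcon
    exact absurd (hε i hi (v i) (hv i) hcon) (by rw [hveq]; exact lt_irrefl _)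
  have hmem : ∑ i ∈ I, v i ∈ msum (fun i => face A w i u) I := by
    apply Set.finsetSum_mem_finsetSum
    intro i hi
    exact subset_convexHull ℝ _ (hvF i hi)
  have h1 := hs _ hmem
  have h2 := hmin (u + ε • f)
  have h3 : ∑ i ∈ I, supp A hA w i (u + ε • f) =
      ∑ i ∈ I, supp A hA w i u + ε * f (∑ i ∈ I, v i) := by
    rw [map_sum, Finset.mul_sum, ← Finset.sum_add_distrib]
    apply Finset.sum_congr rfl
    intro i hi
    rw [hveq, ← face_eq A hA w i u (hvF i hi)]
    simp only [ContinuousLinearMap.add_apply, ContinuousLinearMap.smul_apply, smul_eq_mul]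
    ring
  rw [h3] at h2
  simp only [ContinuousLinearMap.add_apply, ContinuousLinearMap.smul_apply, smul_eq_mul] at h2
  have h4 : ε * f (∑ i ∈ I, v i) < ε * f z := mul_lt_mul_of_pos_left (h1.trans hsz) hεpos
  linarith

include hA in
lemma cover [FiniteDimensional ℝ E] (I : Finset ι) {z : E} (hz : z ∈ interior (msum A I)) :
    ∃ u : StrongDual ℝ E, z ∈ msum (fun i => face A w i u) I := by
  obtain ⟨r, hr, hball⟩ := Metric.nhds_basis_closedBall.mem_iff.mp (mem_interior_iff_mem_nhds.mp hz)
  set C := ∑ i ∈ I, ∑ v ∈ A i, |w i v| with hC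
  have hcont : Continuous (fun u : StrongDual ℝ E => ∑ i ∈ I, supp A hA w i u - u z) := by
    apply Continuous.sub
    · exact continuous_finset_sum _ (fun i _ => supp_continuous A hA w i)
    · fun_prop
  have hbd : ∀ u : StrongDual ℝ E, r * ‖u‖ - C ≤ ∑ i ∈ I, supp A hA w i u - u z := by
    intro u
    have hle : ∀ e : E, ‖e‖ ≤ r → u e ≤ ∑ i ∈ I, supp A hA w i u - u z + C := by
      intro e he
      have hmem : z + e ∈ msum A I := hball (by simpa [Metric.mem_closedBall, dist_eq_norm] using he)
      have := upper_bound A hA w I u hmem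
      rw [map_add] at this
      linarith
    have := ContinuousLinearMap.opNorm_bound_of_ball_bound hr
      (∑ i ∈ I, supp A hA w i u - u z + C) u (by
        intro e he
        have he : ‖e‖ ≤ r := by simpa using he
        rw [Real.norm_eq_abs, abs_le]
        have h1 := hle e he
        have h2 := hle (-e) (by simpa using he)
        rw [map_neg] at h2
        constructor <;> linarith)
    rw [le_div_iff₀ hr] at this
    linarith
  have htend : Filter.Tendsto (fun u : StrongDual ℝ E => ∑ i ∈ I, supp A hA w i u - u z)
      (Filter.cocompact _) Filter.atTop := by
    apply Filter.tendsto_atTop_mono hbd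
    haveI : ProperSpace (StrongDual ℝ E) := FiniteDimensional.proper ℝ _
    exact Filter.tendsto_atTop_add_const_right _ _
      (Filter.Tendsto.const_mul_atTop hr (tendsto_norm_cocompact_atTop (E := StrongDual ℝ E)))
  obtain ⟨u, hu⟩ := hcont.exists_forall_le htend
  exact ⟨u, mem_cell_of_min A hA w I u z hu⟩

variable [FiniteDimensional ℝ E] [MeasurableSpace E] [BorelSpace E]
  (μ : Measure E) [μ.IsAddHaarMeasure]

include hA in
lemma cell_null (I : Finset ι) (u u' : StrongDual ℝ E) (hne : u ≠ u') :
    μ (msum (fun i => face A w i u) I ∩ msum (fun i => face A w i u') I) = 0 := by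
  set c := ∑ i ∈ I, supp A hA w i u' - ∑ i ∈ I, supp A hA w i u with hc
  have hsub : msum (fun i => face A w i u) I ∩ msum (fun i => face A w i u') I ⊆
      {z | (u' - u) z = c} := by
    rintro z ⟨h1, h2⟩
    have h1 := subgrad A hA w I u u' h1
    have h2 := subgrad A hA w I u' u h2
    simp only [ContinuousLinearMap.sub_apply, Set.mem_setOf_eq] at h1 h2 ⊢
    linarith
  apply measure_mono_null hsub
  obtain ⟨e, he⟩ : ∃ e, (u' - u) e ≠ 0 := by
    by_contra hcon
    push Not at hcon
    apply hne
    ext x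
    have := hcon x
    simp only [ContinuousLinearMap.sub_apply] at this
    linarith
  let S : AffineSubspace ℝ E :=
    (AffineSubspace.mk' c ⊥ : AffineSubspace ℝ ℝ).comap ((u' - u : StrongDual ℝ E) : E →ₗ[ℝ] ℝ).toAffineMap
  have hS : (S : Set E) = {z | (u' - u) z = c} := by
    ext z
    simp [S, AffineSubspace.mem_mk', sub_eq_zero]
  rw [← hS]
  apply Measure.addHaar_affineSubspace
  intro htop
  have hall : ∀ z : E, (u' - u) z = c := by
    intro z
    have : z ∈ (S : Set E) := by rw [htop]; trivial
    rw [hS] at this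
    exact this
  have h0 := hall 0
  rw [map_zero] at h0
  exact he ((hall e).trans h0.symm)

include hA in
/-- The volume of each partial Minkowski sum decomposes over a common finite family of cells. -/
lemma decomposition [Fintype ι] : ∃ Φ : Finset (ι → Finset E),
    (∀ φ ∈ Φ, ∃ u : StrongDual ℝ E, φ = fun i => face A w i u) ∧
    ∀ I : Finset ι, (μ (msum A I)).toReal = ∑ φ ∈ Φ, (μ (msum φ I)).toReal := by
  have hfin : (Set.range (fun u : StrongDual ℝ E => fun i => face A w i u)).Finite := by
    apply Set.Finite.subset (Finset.finite_toSet (Fintype.piFinset (fun i => (A i).powerset)))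
    rintro _ ⟨u, rfl⟩
    simp only [Finset.mem_coe, Fintype.mem_piFinset, Finset.mem_powerset]
    exact fun i => face_subset A w i u
  have hmemΦ : ∀ φ, φ ∈ hfin.toFinset ↔ ∃ u : StrongDual ℝ E, φ = fun i => face A w i u := by
    intro φ
    rw [Set.Finite.mem_toFinset]
    exact ⟨fun ⟨u, hu⟩ => ⟨u, hu.symm⟩, fun ⟨u, hu⟩ => ⟨u, hu.symm⟩⟩
  refine ⟨hfin.toFinset, fun φ h => (hmemΦ φ).1 h, ?_⟩
  intro I
  rw [← ENNReal.toReal_sum (fun φ _ => (msum_compact φ I).measure_lt_top.ne)]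
  congr 1
  rw [← measure_biUnion_finset₀]
  · apply le_antisymm
    · have hsub : msum A I ⊆ (⋃ φ ∈ hfin.toFinset, msum φ I) ∪ frontier (msum A I) := by
        intro z hz
        by_cases hi : z ∈ interior (msum A I)
        · left
          obtain ⟨u, hu⟩ := cover A hA w I hi
          simp only [Set.mem_iUnion]
          exact ⟨_, (hmemΦ _).2 ⟨u, rfl⟩, hu⟩
        · right
          exact ⟨subset_closure hz, hi⟩
      refine (measure_mono hsub).trans ((measure_union_le _ _).trans ?_)
      rw [(msum_convex A I).addHaar_frontier μ, add_zero]
    · apply measure_mono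
      intro z hz
      simp only [Set.mem_iUnion] at hz
      obtain ⟨φ, hφ, hz⟩ := hz
      obtain ⟨u, rfl⟩ := (hmemΦ φ).1 hφ
      exact msum_mono _ _ (fun i => face_subset A w i u) I hz
  · intro φ hφ ψ hψ hne
    obtain ⟨u, rfl⟩ := (hmemΦ φ).1 hφ
    obtain ⟨u', rfl⟩ := (hmemΦ ψ).1 hψ
    exact cell_null A hA w μ I u u' (fun h => hne (by rw [h]))
  · intro φ _
    exact (msum_compact φ I).measurableSet.nullMeasurableSet

/-- If one summand is a point, the alternating sum cancels. -/
lemma alt_zero_of_singleton [Fintype ι] (F : ι → Finset E) (j : ι) (p : E) (hp : F j = {p}) :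
    ∑ I ∈ (Finset.univ : Finset ι).powerset, (-1 : ℝ) ^ I.card * (μ (msum F I)).toReal = 0 := by
  have hj : j ∉ (Finset.univ : Finset ι).erase j := by simp
  rw [← Finset.insert_erase (Finset.mem_univ j), Finset.sum_powerset_insert hj,
    ← Finset.sum_add_distrib]
  apply Finset.sum_eq_zero
  intro I hI
  have hjI : j ∉ I := fun h => hj (Finset.mem_powerset.1 hI h)
  have hm : μ (msum F (insert j I)) = μ (msum F I) := by
    unfold msum
    rw [Finset.sum_insert hjI, hp, Finset.coe_singleton, convexHull_singleton, Set.singleton_add,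
      Set.image_add_left, measure_preimage_add]
  rw [Finset.card_insert_of_notMem hjI, hm]
  ring

omit hA w in
lemma alt_zero [Fintype ι] (hA : ∀ i, (A i).Nonempty) {κ : Type*} [Fintype κ] (T : κ → ι)
    (hT : Function.Injective T)
    (hdep : ∀ v v' : κ → E, (∀ j, v j ∈ A (T j)) → (∀ j, v' j ∈ A (T j)) →
      ∃ c : κ → ℝ, ∑ j, c j • (v j - v' j) = 0 ∧ ∃ j, c j ≠ 0) :
    ∑ I ∈ (Finset.univ : Finset ι).powerset, (-1 : ℝ) ^ I.card * (μ (msum A I)).toReal = 0 := by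
  have hdep' : ∀ q : (κ → E) × (κ → E), ∃ c : κ → ℝ, (∃ j, c j ≠ 0) ∧
      ((∀ j, q.1 j ∈ A (T j)) → (∀ j, q.2 j ∈ A (T j)) → ∑ j, c j • (q.1 j - q.2 j) = 0) := by
    intro q
    by_cases h : (∀ j, q.1 j ∈ A (T j)) ∧ (∀ j, q.2 j ∈ A (T j))
    · obtain ⟨c, h1, h2⟩ := hdep q.1 q.2 h.1 h.2
      exact ⟨c, h2, fun _ _ => h1⟩
    · obtain ⟨v, hv⟩ : ∃ v : κ → E, ∀ j, v j ∈ A (T j) :=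
        ⟨fun j => (hA (T j)).choose, fun j => (hA (T j)).choose_spec⟩
      obtain ⟨c, h1, h2⟩ := hdep v v hv hv
      exact ⟨c, h2, fun a b => absurd ⟨a, b⟩ h⟩
  choose c hc0 hc using hdep'
  -- the linear conditions on the lifting to be avoided
  let L : (κ → E) × (κ → E) → ((ι → E → ℝ) →ₗ[ℝ] ℝ) := fun q =>
    ∑ j, c q j • ((LinearMap.proj (q.1 j)).comp (LinearMap.proj (T j) : (ι → E → ℝ) →ₗ[ℝ] (E → ℝ)) -
      (LinearMap.proj (q.2 j)).comp (LinearMap.proj (T j) : (ι → E → ℝ) →ₗ[ℝ] (E → ℝ)))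
  have hL : ∀ q (w : ι → E → ℝ), L q w = ∑ j, c q j * (w (T j) (q.1 j) - w (T j) (q.2 j)) := by
    intro q w
    simp [L, LinearMap.sum_apply]
  let Q : Finset ((κ → E) × (κ → E)) :=
    ((Fintype.piFinset (fun j => A (T j))) ×ˢ (Fintype.piFinset (fun j => A (T j)))).filter
      (fun q => ∀ j, q.1 j ≠ q.2 j)
  have htop : (⊤ : Subspace ℝ (ι → E → ℝ)) ∉ Q.image (fun q => LinearMap.ker (L q)) := by
    intro h
    rw [Finset.mem_image] at h
    obtain ⟨q, hq, hk⟩ := h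
    have hq2 := (Finset.mem_filter.1 hq).2
    obtain ⟨j, hj⟩ := hc0 q
    have hw : Pi.single (T j) (Pi.single (q.1 j) (1 : ℝ)) ∈ LinearMap.ker (L q) := by
      rw [hk]; trivial
    rw [LinearMap.mem_ker, hL, Finset.sum_eq_single j] at hw
    · simp [Pi.single_eq_of_ne (hq2 j).symm] at hw
      exact hj hw
    · intro j' _ hne
      rw [Pi.single_eq_of_ne (fun h => hne (hT h))]
      simp
    · simp
  obtain ⟨w, hw⟩ : ∃ w : ι → E → ℝ, ∀ q ∈ Q, L q w ≠ 0 := by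
    have := Subspace.biUnion_ne_univ_of_top_notMem htop
    rw [Set.ne_univ_iff_exists_notMem] at this
    obtain ⟨w, hw⟩ := this
    refine ⟨w, fun q hq h0 => hw ?_⟩
    simp only [Set.mem_iUnion]
    exact ⟨_, Finset.mem_image_of_mem _ hq, h0⟩
  obtain ⟨Φ, hΦ, hvol⟩ := decomposition A hA w μ
  simp_rw [hvol, Finset.mul_sum]
  rw [Finset.sum_comm]
  apply Finset.sum_eq_zero
  intro φ hφ
  obtain ⟨u, rfl⟩ := hΦ φ hφ
  obtain ⟨j, hj⟩ : ∃ j, (face A w (T j) u).card ≤ 1 := by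
    by_contra hcon
    push Not at hcon
    have h2 := fun j => Finset.one_lt_card.1 (hcon j)
    choose v hv v' hv' hne using h2
    have hvA := fun j => face_subset A w _ u (hv j)
    have hvA' := fun j => face_subset A w _ u (hv' j)
    apply hw (v, v')
    · simp only [Q, Finset.mem_filter, Finset.mem_product, Fintype.mem_piFinset]
      exact ⟨⟨hvA, hvA'⟩, hne⟩
    · have h0 := hc (v, v') hvA hvA'
      have h1 := congrArg u h0
      rw [map_sum, map_zero] at h1
      rw [hL, ← h1]
      apply Finset.sum_congr rfl
      intro j _
      have e1 := face_eq A hA w _ u (hv j)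
      have e2 := face_eq A hA w _ u (hv' j)
      rw [map_smul, map_sub, smul_eq_mul]
      congr 1
      linarith
  obtain ⟨p, hp⟩ := Finset.card_eq_one.1
    (le_antisymm hj (Finset.card_pos.2 (face_nonempty A hA w (T j) u)))
  exact alt_zero_of_singleton μ (fun i => face A w i u) (T j) p hp

end Abstract

end VoffAux

/-- **Stretched `B_k`-sets have vanishing mixed volume of off-coordinate
polytopes.** Let `AA = A₀ ∗_{s 0} A₁ ∗ ⋯ ∗_{s (b-1)} A_b ⊆ ℤᵃ ⊕ ℤᵇ_{≥0}` be a
stretched Cayley sum (`a = n − k`, `b = k`) of finite lattice sets with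
`dim (A₁ + ⋯ + A_b) < b` and `dim A₀ = a`, with positive stretch factors `s j`.
If `AA` lies in `ℝⁿ_{≥0}` and the off-coordinate polytopes
`D idx = Conv (AA ∖ {x_idx = 0})` are nonempty, then their mixed volume
vanishes: `Voff_{ℝⁿ_{≥0}}(AA) = 0`. -/
theorem stretched_Bk_Voff_zero (a b : ℕ)
    (Ai : Fin (b + 1) → Finset (Fin a → ℝ))
    (hlat : ∀ i, ∀ p ∈ Ai i, ∀ j, ∃ m : ℤ, p j = (m : ℝ))
    (st : Fin b → ℤ) (hst : ∀ j, 0 < st j)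
    (hdimsum : Module.finrank ℝ
      (vectorSpan ℝ (∑ j : Fin b, ((Ai j.succ : Set (Fin a → ℝ))))) < b)
    (hdim0 : Module.finrank ℝ (vectorSpan ℝ ((Ai 0 : Set (Fin a → ℝ)))) = a)
    (AA : Finset ((Fin a → ℝ) × (Fin b → ℝ)))
    (hAA : (AA : Set ((Fin a → ℝ) × (Fin b → ℝ))) =
      ((Ai 0 : Set (Fin a → ℝ)) ×ˢ ({0} : Set (Fin b → ℝ))) ∪
      ⋃ j : Fin b, ((Ai j.succ : Set (Fin a → ℝ)) ×ˢ
        ({fun j' => if j' = j then (st j : ℝ) else 0} : Set (Fin b → ℝ))))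
    (hnonneg : ∀ x ∈ AA, (∀ i, 0 ≤ x.1 i) ∧ (∀ j, 0 ≤ x.2 j))
    (D : Fin a ⊕ Fin b → Set ((Fin a → ℝ) × (Fin b → ℝ)))
    (hD : ∀ idx, D idx =
      convexHull ℝ ((AA : Set ((Fin a → ℝ) × (Fin b → ℝ))) \ {x | coordP a b idx x = 0}))
    (hne : ∀ idx, (D idx).Nonempty) :
    mixedVolP a b D = 0 := by
  classical
  have hb : 0 < b := lt_of_le_of_lt (Nat.zero_le _) hdimsum
  let A : Fin a ⊕ Fin b → Finset ((Fin a → ℝ) × (Fin b → ℝ)) := fun idx =>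
    AA.filter (fun x => coordP a b idx x ≠ 0)
  have hDA : ∀ idx, D idx = convexHull ℝ (A idx : Set ((Fin a → ℝ) × (Fin b → ℝ))) := by
    intro idx
    rw [hD]
    congr 1
    ext x
    simp [A]
  have hAne : ∀ idx, (A idx).Nonempty := by
    intro idx
    have h := hne idx
    rw [hDA, convexHull_nonempty_iff] at h
    exact_mod_cast h
  -- description of the pieces attached to the last coordinates
  have hAr : ∀ (j : Fin b) (x), x ∈ A (Sum.inr j) →
      x.1 ∈ Ai j.succ ∧ x.2 = fun j' => if j' = j then (st j : ℝ) else 0 := by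
    intro j x hx
    obtain ⟨hx1, hx2⟩ := Finset.mem_filter.1 hx
    have hx2 : x.2 j ≠ 0 := hx2
    have hx1 : x ∈ (AA : Set ((Fin a → ℝ) × (Fin b → ℝ))) := hx1
    rw [hAA] at hx1
    rcases hx1 with h | h
    · exact absurd (by rw [Set.mem_singleton_iff.1 h.2]; rfl) hx2
    · obtain ⟨j', hj'⟩ := Set.mem_iUnion.1 h
      have h2 := Set.mem_singleton_iff.1 hj'.2
      have hjj : j = j' := by
        by_contra hcon
        apply hx2
        rw [h2]
        simp [hcon]
      subst hjj
      exact ⟨hj'.1, h2⟩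
  have hdep : ∀ v v' : Fin b → (Fin a → ℝ) × (Fin b → ℝ), (∀ j, v j ∈ A (Sum.inr j)) →
      (∀ j, v' j ∈ A (Sum.inr j)) →
      ∃ c : Fin b → ℝ, ∑ j, c j • (v j - v' j) = 0 ∧ ∃ j, c j ≠ 0 := by
    intro v v' hv hv'
    set W := vectorSpan ℝ (∑ j : Fin b, ((Ai j.succ : Set (Fin a → ℝ)))) with hW
    have hmem : ∀ j, (v j).1 - (v' j).1 ∈ W := by
      intro j
      have h1 : ∑ i, (v i).1 ∈ ∑ j : Fin b, ((Ai j.succ : Set (Fin a → ℝ))) :=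
        Set.finsetSum_mem_finsetSum _ _ _ (fun i _ => (hAr i _ (hv i)).1)
      have h2 : ∑ i, (if i = j then (v' j).1 else (v i).1) ∈
          ∑ j : Fin b, ((Ai j.succ : Set (Fin a → ℝ))) := by
        apply Set.finsetSum_mem_finsetSum
        intro i _
        by_cases hij : i = j
        · subst hij
          simpa using (hAr i _ (hv' i)).1
        · simpa [hij] using (hAr i _ (hv i)).1
      have h3 := vsub_mem_vectorSpan ℝ h1 h2
      have h4 : ∑ i, (v i).1 - ∑ i, (if i = j then (v' j).1 else (v i).1) =
          (v j).1 - (v' j).1 := by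
        rw [← Finset.sum_sub_distrib, Finset.sum_eq_single j]
        · simp
        · intro i _ hij
          simp [hij]
        · simp
      rw [vsub_eq_sub, h4] at h3
      exact h3
    have hnot : ¬ LinearIndependent ℝ (fun j => (⟨_, hmem j⟩ : W)) := by
      intro hli
      have := hli.fintype_card_le_finrank
      rw [Fintype.card_fin] at this
      omega
    rw [Fintype.not_linearIndependent_iff] at hnot
    obtain ⟨c, hc, hc0⟩ := hnot
    refine ⟨c, ?_, hc0⟩
    have hc1 : ∑ j, c j • ((v j).1 - (v' j).1) = 0 := by
      have := congrArg (W.subtype) hc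
      simpa [map_sum] using this
    apply Prod.ext
    · rw [Prod.fst_sum]
      simpa using hc1
    · rw [Prod.snd_sum]
      apply Finset.sum_eq_zero
      intro j _
      rw [Prod.smul_snd, Prod.snd_sub, (hAr j _ (hv j)).2, (hAr j _ (hv' j)).2]
      simp
  have hHaar : (volume : Measure ((Fin a → ℝ) × (Fin b → ℝ))).IsAddHaarMeasure :=
    Measure.prod.instIsAddHaarMeasure (volume : Measure (Fin a → ℝ))
      (volume : Measure (Fin b → ℝ))
  have key := VoffAux.alt_zero A (volume : Measure ((Fin a → ℝ) × (Fin b → ℝ))) hAne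
    (Sum.inr : Fin b → Fin a ⊕ Fin b) Sum.inr_injective hdep
  have hempty : (volume (0 : Set ((Fin a → ℝ) × (Fin b → ℝ)))) = 0 := by
    have : Nonempty (Fin b) := ⟨⟨0, hb⟩⟩
    have : Nontrivial ((Fin a → ℝ) × (Fin b → ℝ)) := inferInstance
    have : (volume ({0} : Set ((Fin a → ℝ) × (Fin b → ℝ)))) = 0 := by
      rw [Measure.volume_eq_prod, ← Prod.mk_zero_zero, ← Set.singleton_prod_singleton,
        Measure.prod_prod, measure_singleton (0 : Fin b → ℝ), mul_zero]
    exact this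
  unfold mixedVolP latVolP
  have hstep : ∀ I ∈ (Finset.univ : Finset (Fin a ⊕ Fin b)).powerset,
      (if I.Nonempty then (-1 : ℝ) ^ (a + b - I.card) *
        ((Nat.factorial (a + b) : ℝ) * (volume (∑ i ∈ I, D i)).toReal) else 0) =
      ((-1 : ℝ) ^ (a + b) * (Nat.factorial (a + b) : ℝ)) *
        ((-1 : ℝ) ^ I.card * (volume (VoffAux.msum A I)).toReal) := by
    intro I _
    have hms : VoffAux.msum A I = ∑ i ∈ I, D i := by
      unfold VoffAux.msum
      exact Finset.sum_congr rfl (fun i _ => (hDA i).symm)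
    rw [hms]
    split_ifs with hI
    · have hcard : I.card ≤ a + b := by
        have := Finset.card_le_univ I
        simpa using this
      have hs : (-1 : ℝ) ^ (a + b - I.card) = (-1 : ℝ) ^ (a + b) * (-1 : ℝ) ^ I.card := by
        obtain ⟨m, hm⟩ := Nat.exists_eq_add_of_le hcard
        have h1 : (-1 : ℝ) ^ I.card * (-1 : ℝ) ^ I.card = 1 := by
          rw [← mul_pow]; norm_num
        rw [hm, Nat.add_sub_cancel_left, pow_add]
        linear_combination (-(-1 : ℝ) ^ m) * h1
      rw [hs]
      ring
    · rw [Finset.not_nonempty_iff_eq_empty.1 hI, Finset.sum_empty, hempty]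
      simp
  rw [Finset.sum_congr rfl hstep, ← Finset.mul_sum, key, mul_zero]


end
end

section
/- Let 𝐏 ⊂ ℤ^n be a finite set with P = Conv(𝐏), let D_1, …, D_n be daughter polytopes of 𝐏 that are semi-interlaced in 𝐏, and let S ∈ Θ(P) be a suture with complement index set J = {j_1,…,j_{n−dim S}} of I = {i : D_i ∩ S ≠ ∅}. Let ξ be a linear functional on π_S(ℝ^n) whose maximizing face on π_S(P) is exactly the point O_S = π_S(S), and suppose that P̃_S(ξ) = Conv({O_S} ∪ Y), where Y = (𝐏_S ∖ {O_S})^ξ is the subset of 𝐏_S ∖ {O_S} maximizing ξ. Then the polytopes π_S(D̃_j)(ξ), j ∈ J, are interlaced in P̃_S(ξ), i.e. every proper face K of P̃_S(ξ) intersects at least dim(K) + 1 of them. -/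
open Pointwise Filter
open scoped Classical

noncomputable section

def intLattice (n : ℕ) : AddSubgroup (Fin n → ℝ) where
  carrier := {x | ∀ i, ∃ m : ℤ, x i = (m : ℝ)}
  zero_mem' := fun i => ⟨0, by simp⟩
  add_mem' := by
    intro a b ha hb i
    obtain ⟨p, hp⟩ := ha i
    obtain ⟨q, hq⟩ := hb i
    exact ⟨p + q, by simp [hp, hq]⟩
  neg_mem' := by
    intro a ha i
    obtain ⟨p, hp⟩ := ha i
    exact ⟨-p, by simp [hp]⟩

/-- Mixed volume of the polytopes `Q i`, `i ∈ T`, via inclusion-exclusion of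
lattice volumes of Minkowski sums. -/
def mixedVol {E : Type*} [AddCommGroup E] [Module ℝ E] {ι : Type*}
    (L : AddSubgroup E) (T : Finset ι) (Q : ι → Set E) : ℝ :=
  ∑ I ∈ T.powerset,
    if I.Nonempty then
      (-1 : ℝ) ^ (T.card - I.card) * latVol L T.card (∑ i ∈ I, Q i)
    else 0

/-- `F` is a face of `P`: the set of maximizers over `P` of some linear functional. -/
def IsFaceOf {E : Type*} [AddCommGroup E] [Module ℝ E] (P F : Set E) : Prop :=
  ∃ ξ : E →ₗ[ℝ] ℝ, F = {x ∈ P | ∀ y ∈ P, ξ y ≤ ξ x}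

/-- Dimension of (the affine span of) a set. -/
def sdim {E : Type*} [AddCommGroup E] [Module ℝ E] (Q : Set E) : ℕ :=
  Module.finrank ℝ (vectorSpan ℝ Q)

/-- The family D-family: faces of `P` maximal among the faces disjoint from `D`. -/
def DFam {E : Type*} [AddCommGroup E] [Module ℝ E] (P D : Set E) : Set (Set E) :=
  {F | Maximal (fun G => IsFaceOf P G ∧ G ∩ D = ∅) F}

/-- `D` is a daughter polytope of the finite set `A`. -/
def IsDaughter {E : Type*} [AddCommGroup E] [Module ℝ E] (A : Finset E) (D : Set E) : Prop :=
  D.Nonempty ∧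
  (∀ F ∈ DFam (convexHull ℝ (A : Set E)) D, ∀ F' ∈ DFam (convexHull ℝ (A : Set E)) D,
    F ≠ F' → F ∩ F' = ∅) ∧
  D = convexHull ℝ ((A : Set E) \ ⋃ F ∈ DFam (convexHull ℝ (A : Set E)) D, F)

/-- The daughter polytopes `D i`, `i ∈ T`, are semi-interlaced in `A`. -/
def SemiInterlaced {E : Type*} [AddCommGroup E] [Module ℝ E] {ι : Type*}
    (A : Finset E) (T : Finset ι) (D : ι → Set E) : Prop :=
  (∀ i ∈ T, IsDaughter A (D i)) ∧
  ∀ F, IsFaceOf (convexHull ℝ (A : Set E)) F →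
    sdim F ≤ (T.filter fun i => (D i ∩ F).Nonempty).card

/-- A face `F` of `Conv A` is a suture if exactly `dim F` of the `D i` meet it. -/
def IsSuture {E : Type*} [AddCommGroup E] [Module ℝ E] {ι : Type*}
    (A : Finset E) (T : Finset ι) (D : ι → Set E) (F : Set E) : Prop :=
  IsFaceOf (convexHull ℝ (A : Set E)) F ∧
  (T.filter fun i => (D i ∩ F).Nonempty).card = sdim F


/-- For a polyhedron `Q ⊆ E ⊕ ℝ`, the set `Q(ξ)`: the image in `E` of the face
of `Q` on which the functional `(ξ, 1)` attains its maximum. -/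
def supFaceSlice {E : Type*} [AddCommGroup E] [Module ℝ E]
    (ξ : E →ₗ[ℝ] ℝ) (Q : Set (E × ℝ)) : Set E :=
  Prod.fst '' {x ∈ Q | ∀ y ∈ Q, ξ y.1 + y.2 ≤ ξ x.1 + x.2}

/-- The polyhedron `D̃ = Conv({(a,y) : a ∈ D, y ≤ 0} ∪ {(a,y) : a ∈ P, y ≤ −1})`. -/
def tildeD {E : Type*} [AddCommGroup E] [Module ℝ E] (D P : Set E) : Set (E × ℝ) :=
  convexHull ℝ ({p : E × ℝ | p.1 ∈ D ∧ p.2 ≤ 0} ∪ {p : E × ℝ | p.1 ∈ P ∧ p.2 ≤ -1})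

/-- The polyhedron `P̃_S = Conv({(a,y) : a ∈ A_S ∖ {O}, y ≤ 0} ∪ {(O,y) : y ≤ −1})`. -/
def tildeP {E : Type*} [AddCommGroup E] [Module ℝ E] (AS : Set E) (O : E) : Set (E × ℝ) :=
  convexHull ℝ ({p : E × ℝ | p.1 ∈ AS \ {O} ∧ p.2 ≤ 0} ∪ {p : E × ℝ | p.1 = O ∧ p.2 ≤ -1})

/-- The set `A_S = π_S(A) ∩ closure (π_S(P) ∖ π_S(Conv (A ∖ S)))` in the quotient
of `ℝⁿ` by `aff S`. -/
def projSet (n : ℕ) (A : Finset (Fin n → ℝ)) (S : Set (Fin n → ℝ)) :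
    Set ((Fin n → ℝ) ⧸ vectorSpan ℝ S) :=
  ((vectorSpan ℝ S).mkQ '' (A : Set (Fin n → ℝ))) ∩
    closure (((vectorSpan ℝ S).mkQ '' convexHull ℝ (A : Set (Fin n → ℝ))) \
      ((vectorSpan ℝ S).mkQ '' convexHull ℝ ((A : Set (Fin n → ℝ)) \ S)))

section Helpers

variable {E : Type*} [AddCommGroup E] [Module ℝ E]

theorem hull_le {X : Set E} {ζ : E →ₗ[ℝ] ℝ} {M : ℝ} (h : ∀ x ∈ X, ζ x ≤ M) {x : E}
    (hx : x ∈ convexHull ℝ X) : ζ x ≤ M :=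
  convexHull_min (t := {x | ζ x ≤ M}) (fun x hx => h x hx)
    (convex_halfSpace_le ζ.isLinear M) hx

theorem hull_eq {X : Set E} {ζ : E →ₗ[ℝ] ℝ} {M : ℝ} (h : ∀ x ∈ X, ζ x ≤ M) {x : E}
    (hx : x ∈ convexHull ℝ X) (hM : ζ x = M) : x ∈ convexHull ℝ (X ∩ {x | ζ x = M}) := by
  have hC : ∀ z ∈ convexHull ℝ (X ∩ {x | ζ x = M}), ζ z = M := fun z hz =>
    convexHull_min (t := {x | ζ x = M}) (fun x hx => hx.2)
      (convex_hyperplane ζ.isLinear M) hz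
  have key : x ∈ {z | ζ z < M ∨ z ∈ convexHull ℝ (X ∩ {x | ζ x = M})} := by
    refine convexHull_min ?_ ?_ hx
    · intro z hz
      rcases (h z hz).lt_or_eq with h1 | h1
      · exact Or.inl h1
      · exact Or.inr (subset_convexHull ℝ _ ⟨hz, h1⟩)
    · intro a ha b hb s t hs ht hst
      rcases hs.eq_or_lt with rfl | hs
      · have : t = 1 := by linarith
        subst this; simpa using hb
      rcases ht.eq_or_lt with rfl | ht
      · have : s = 1 := by linarith
        subst this; simpa using ha
      have e : s * M + t * M = M := by rw [← add_mul, hst, one_mul]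
      rcases ha with ha | ha <;> rcases hb with hb | hb
      · left
        simp only [map_add, map_smul, smul_eq_mul]
        linarith [mul_lt_mul_of_pos_left ha hs, mul_lt_mul_of_pos_left hb ht]
      · left
        have := hC _ hb
        simp only [map_add, map_smul, smul_eq_mul]
        rw [this]
        linarith [mul_lt_mul_of_pos_left ha hs]
      · left
        have := hC _ ha
        simp only [map_add, map_smul, smul_eq_mul]
        rw [this]
        linarith [mul_lt_mul_of_pos_left hb ht]
      · right
        exact (convex_convexHull ℝ _) ha hb hs.le ht.le hst
  rcases key with h1 | h1
  · exact absurd hM h1.ne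
  · exact h1

theorem face_hull {X F : Set E} (hF : IsFaceOf (convexHull ℝ X) F) :
    F = convexHull ℝ (X ∩ F) := by
  obtain ⟨ζ, hζ⟩ := hF
  apply Set.Subset.antisymm
  · intro x hx
    have hx' := hx
    rw [hζ] at hx'
    have := hull_eq (fun z hz => hx'.2 z (subset_convexHull ℝ _ hz)) hx'.1 rfl
    refine convexHull_mono ?_ this
    rintro z ⟨hz, hz2⟩
    refine ⟨hz, ?_⟩
    rw [hζ]
    refine ⟨subset_convexHull ℝ _ hz, fun y hy => ?_⟩
    have := hx'.2 y hy
    have h3 : ζ z = ζ x := hz2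
    linarith
  · apply convexHull_min Set.inter_subset_right
    intro a ha b hb s t hs ht hst
    rw [hζ] at ha hb ⊢
    refine ⟨convex_convexHull ℝ _ ha.1 hb.1 hs ht hst, fun y hy => ?_⟩
    have h1 := ha.2 y hy
    have h2 := hb.2 y hy
    have hs' : s = 1 - t := by linarith
    subst hs'
    simp only [map_add, map_smul, smul_eq_mul]
    nlinarith

theorem face_sub {P F : Set E} (hF : IsFaceOf P F) : F ⊆ P := by
  obtain ⟨ζ, rfl⟩ := hF
  exact fun x hx => hx.1

theorem face_inter {P F G : Set E} (hF : IsFaceOf P F) (hG : IsFaceOf P G)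
    (h : (F ∩ G).Nonempty) : IsFaceOf P (F ∩ G) := by
  obtain ⟨ζ, rfl⟩ := hF
  obtain ⟨η, rfl⟩ := hG
  obtain ⟨z, hz1, hz2⟩ := h
  refine ⟨ζ + η, ?_⟩
  ext x
  constructor
  · rintro ⟨h1, h2⟩
    refine ⟨h1.1, fun y hy => ?_⟩
    have := h1.2 y hy
    have := h2.2 y hy
    simp only [LinearMap.add_apply]; linarith
  · rintro ⟨h1, h2⟩
    have h3 := h2 z hz1.1
    simp only [LinearMap.add_apply] at h3
    have h4 := hz1.2 x h1
    have h5 := hz2.2 x h1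
    refine ⟨⟨h1, fun y hy => ?_⟩, ⟨h1, fun y hy => ?_⟩⟩
    · have := hz1.2 y hy
      linarith
    · have := hz2.2 y hy
      linarith

theorem exists_DFam (A : Finset E) (D : Set E) {F : Set E}
    (hF : IsFaceOf (convexHull ℝ (A : Set E)) F) (hD : F ∩ D = ∅) :
    ∃ G ∈ DFam (convexHull ℝ (A : Set E)) D, F ⊆ G := by
  let Q : ℕ → Prop := fun k => ∃ G, IsFaceOf (convexHull ℝ (A : Set E)) G ∧ G ∩ D = ∅ ∧ F ⊆ G ∧
    A.card - (A.filter (· ∈ G)).card = k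
  have hQ : ∃ k, Q k := ⟨_, F, hF, hD, le_rfl, rfl⟩
  obtain ⟨G, hG, hGD, hFG, hk⟩ := Nat.find_spec hQ
  refine ⟨G, ⟨⟨hG, hGD⟩, ?_⟩, hFG⟩
  rintro G' ⟨hG', hGD'⟩ hle
  have hmin := Nat.find_min' hQ ⟨G', hG', hGD', hFG.trans hle, rfl⟩
  rw [← hk] at hmin
  have hsub : A.filter (· ∈ G) ⊆ A.filter (· ∈ G') := by
    intro x hx
    rw [Finset.mem_filter] at hx ⊢
    exact ⟨hx.1, hle hx.2⟩
  have c1 := Finset.card_le_card (Finset.filter_subset (· ∈ G') A)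
  have c2 := Finset.card_le_card (Finset.filter_subset (· ∈ G) A)
  have heq := Finset.eq_of_subset_of_card_le hsub (by omega)
  show G' ⊆ G
  rw [face_hull hG', face_hull hG]
  apply convexHull_mono
  rintro x ⟨hx, hx2⟩
  have : x ∈ A.filter (· ∈ G) := by rw [heq]; exact Finset.mem_filter.2 ⟨hx, hx2⟩
  exact ⟨hx, (Finset.mem_filter.1 this).2⟩

theorem exists_minface (A : Finset E) {B : Set E} (hB : B.Nonempty)
    (hBP : B ⊆ convexHull ℝ (A : Set E)) :
    ∃ F, IsFaceOf (convexHull ℝ (A : Set E)) F ∧ B ⊆ F ∧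
      ∀ G, IsFaceOf (convexHull ℝ (A : Set E)) G → B ⊆ G → F ⊆ G := by
  let Q : ℕ → Prop := fun k => ∃ G, IsFaceOf (convexHull ℝ (A : Set E)) G ∧ B ⊆ G ∧
    (A.filter (· ∈ G)).card = k
  have hQ : ∃ k, Q k := ⟨_, convexHull ℝ (A : Set E), ⟨0, by simp⟩, hBP, rfl⟩
  obtain ⟨F, hF, hBF, hk⟩ := Nat.find_spec hQ
  refine ⟨F, hF, hBF, fun G hG hBG => ?_⟩
  have hBi : B ⊆ F ∩ G := Set.subset_inter hBF hBG
  have hmin := Nat.find_min' hQ ⟨F ∩ G, face_inter hF hG (hB.mono hBi), hBi, rfl⟩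
  rw [← hk] at hmin
  have hsub : A.filter (· ∈ F ∩ G) ⊆ A.filter (· ∈ F) := by
    intro x hx
    rw [Finset.mem_filter] at hx ⊢
    exact ⟨hx.1, hx.2.1⟩
  have heq := Finset.eq_of_subset_of_card_le hsub (by convert hmin)
  rw [face_hull hF, face_hull hG]
  apply convexHull_mono
  rintro x ⟨hx, hx2⟩
  have : x ∈ A.filter (· ∈ F ∩ G) := by rw [heq]; exact Finset.mem_filter.2 ⟨hx, hx2⟩
  exact ⟨hx, (Finset.mem_filter.1 this).2.2⟩

/-- The key rotation argument: `θ` takes value `c+1` on `A ∩ S` and at most `c` on the rest. -/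
theorem mem_of_rot (A : Finset E) (D S G : Set E) (θ : E →ₗ[ℝ] ℝ) (c : ℝ)
    (hD : IsDaughter A D) (hS : IsFaceOf (convexHull ℝ (A : Set E)) S)
    (hSD : S ∩ D = ∅) (hSne : S.Nonempty)
    (hθS : ∀ s ∈ S, θ s = c + 1) (hθ : ∀ a ∈ A, a ∉ S → θ a ≤ c)
    (hG : G ∈ DFam (convexHull ℝ (A : Set E)) D) (hSG : S ⊆ G)
    (a : E) (ha : a ∈ A) (hac : θ a = c) (haD : a ∉ D) : a ∈ G := by
  obtain ⟨-, hdis, hDe⟩ := hD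
  have huniq : ∀ F ∈ DFam (convexHull ℝ (A : Set E)) D, (F ∩ S).Nonempty → F = G := by
    intro F hF hne
    by_contra hne'
    have := hdis F hF G hG hne'
    obtain ⟨z, hz1, hz2⟩ := hne
    have hz : z ∈ F ∩ G := ⟨hz1, hSG hz2⟩
    rw [this] at hz
    exact hz
  have hex : ∃ F ∈ DFam (convexHull ℝ (A : Set E)) D, a ∈ F := by
    by_contra hcon
    apply haD
    rw [hDe]
    apply subset_convexHull
    refine ⟨ha, ?_⟩
    simpa using hcon
  obtain ⟨F, hF, haF⟩ := hex
  by_cases hFS : (F ∩ S).Nonempty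
  · rw [← huniq F hF hFS]; exact haF
  obtain ⟨⟨⟨η, hη⟩, hFD⟩, -⟩ := id hF
  have haη : ∀ y ∈ convexHull ℝ (A : Set E), η y ≤ η a := by
    rw [hη] at haF; exact haF.2
  have hAS : (A.filter (· ∈ S)).Nonempty := by
    rw [face_hull hS] at hSne
    obtain ⟨x, hx, hx2⟩ := convexHull_nonempty_iff.1 hSne
    exact ⟨x, Finset.mem_filter.2 ⟨hx, hx2⟩⟩
  obtain ⟨s, hs, hsmax⟩ := Finset.exists_max_image _ (fun x => η x) hAS
  rw [Finset.mem_filter] at hs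
  have hlt : η s < η a := by
    refine lt_of_le_of_ne (haη s (subset_convexHull ℝ _ hs.1)) fun h => hFS ⟨s, ?_, hs.2⟩
    rw [hη]
    exact ⟨subset_convexHull ℝ _ hs.1, fun y hy => by rw [h]; exact haη y hy⟩
  set t := η a - η s with ht
  have ht0 : 0 < t := by linarith
  let φ : E →ₗ[ℝ] ℝ := η + t • θ
  have hφ : ∀ x, φ x = η x + t * θ x := fun x => by simp [φ]
  have hφA : ∀ x ∈ (A : Set E), φ x ≤ φ a := by
    intro x hx
    rw [hφ, hφ, hac]
    by_cases hxS : x ∈ S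
    · have := hsmax x (Finset.mem_filter.2 ⟨hx, hxS⟩)
      rw [hθS x hxS]
      nlinarith
    · have h1 := hθ x hx hxS
      have h2 := haη x (subset_convexHull ℝ _ hx)
      nlinarith
  have hφP : ∀ x ∈ convexHull ℝ (A : Set E), φ x ≤ φ a := fun x hx => hull_le hφA hx
  let R : Set E := {x ∈ convexHull ℝ (A : Set E) | ∀ y ∈ convexHull ℝ (A : Set E), φ y ≤ φ x}
  have hR : IsFaceOf (convexHull ℝ (A : Set E)) R := ⟨φ, rfl⟩
  have haR : a ∈ R := ⟨subset_convexHull ℝ _ ha, hφP⟩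
  have hsR : s ∈ R := by
    refine ⟨subset_convexHull ℝ _ hs.1, fun y hy => ?_⟩
    have := hφP y hy
    have h2 : φ s = φ a := by
      rw [hφ, hφ, hac, hθS s hs.2]; ring_nf; rw [ht]; ring
    rw [h2]; exact this
  have hRA : ∀ x ∈ A, x ∈ R → x ∉ D := by
    intro x hx hxR hxD
    have hge := hxR.2 a (subset_convexHull ℝ _ ha)
    by_cases hxS : x ∈ S
    · have : x ∈ S ∩ D := ⟨hxS, hxD⟩
      rw [hSD] at this; exact this
    · have h1 := hθ x hx hxS
      have h2 := haη x (subset_convexHull ℝ _ hx)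
      rw [hφ, hφ, hac] at hge
      have h3 : η x = η a := by nlinarith
      have : x ∈ F ∩ D := by
        refine ⟨?_, hxD⟩
        rw [hη]
        exact ⟨subset_convexHull ℝ _ hx, fun y hy => by rw [h3]; exact haη y hy⟩
      rw [hFD] at this; exact this
  have hRD : R ∩ D = ∅ := by
    rw [Set.eq_empty_iff_forall_notMem]
    rintro x ⟨hxR, hxD⟩
    set X := (A : Set E) \ ⋃ F ∈ DFam (convexHull ℝ (A : Set E)) D, F with hX
    rw [hDe] at hxD
    have hxa : φ x = φ a := le_antisymm (hφP x hxR.1) (hxR.2 a haR.1)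
    have := hull_eq (fun z hz => hφA z (Set.sdiff_subset hz)) hxD hxa
    obtain ⟨z, hz, hz2⟩ := convexHull_nonempty_iff.1 ⟨x, this⟩
    have hz3 : φ z = φ a := hz2
    refine hRA z hz.1 ⟨subset_convexHull ℝ _ hz.1, fun y hy => by rw [hz3]; exact hφP y hy⟩ ?_
    rw [hDe]
    exact subset_convexHull ℝ _ hz
  obtain ⟨G', hG', hRG⟩ := exists_DFam A D hR hRD
  rw [← huniq G' hG' ⟨s, hRG hsR, hs.2⟩]
  exact hRG haR

theorem vspan_le {K : Set E} {W : Submodule ℝ E} (h : ∀ a ∈ K, ∀ b ∈ K, a - b ∈ W) :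
    vectorSpan ℝ K ≤ W := by
  rw [vectorSpan, Submodule.span_le]
  rintro _ ⟨a, ha, b, hb, rfl⟩
  exact h a ha b hb

end Helpers

/-- **Case 1 of the proof of the main lemma: interlacedness.**
In the setting of the main lemma, if `P̃_S(ξ) = Conv({O_S} ∪ Y)` with
`Y = (A_S ∖ {O_S})^ξ`, then the polytopes `π_S(D̃_j)(ξ)`, `j ∈ J`, are
interlaced in `P̃_S(ξ)`: every proper face `K` of `P̃_S(ξ)` meets at least
`dim K + 1` of them. -/
theorem main_lemma_case_interlaced (n : ℕ) (A : Finset (Fin n → ℝ))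
    (hlat : ∀ p ∈ A, p ∈ intLattice n)
    (P : Set (Fin n → ℝ)) (hP : P = convexHull ℝ (A : Set (Fin n → ℝ)))
    (D : Fin n → Set (Fin n → ℝ))
    (hsemi : SemiInterlaced A Finset.univ D)
    (S : Set (Fin n → ℝ)) (hS : IsSuture A Finset.univ D S)
    (O : (Fin n → ℝ) ⧸ vectorSpan ℝ S)
    (hO : (vectorSpan ℝ S).mkQ '' S = {O})
    (ξ : ((Fin n → ℝ) ⧸ vectorSpan ℝ S) →ₗ[ℝ] ℝ)
    (hξ : {x ∈ (vectorSpan ℝ S).mkQ '' P |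
        ∀ y ∈ (vectorSpan ℝ S).mkQ '' P, ξ y ≤ ξ x} = {O})
    (J : Finset (Fin n)) (hJ : J = Finset.univ.filter fun i => ¬(D i ∩ S).Nonempty)
    (Y : Set ((Fin n → ℝ) ⧸ vectorSpan ℝ S))
    (hY : Y = {x ∈ projSet n A S \ {O} | ∀ y ∈ projSet n A S \ {O}, ξ y ≤ ξ x})
    (hcase : supFaceSlice ξ (tildeP (projSet n A S) O) = convexHull ℝ ({O} ∪ Y)) :
    ∀ K, IsFaceOf (supFaceSlice ξ (tildeP (projSet n A S) O)) K →
      K ≠ supFaceSlice ξ (tildeP (projSet n A S) O) →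
      sdim K + 1 ≤ (J.filter fun j =>
        ((supFaceSlice ξ
          (((vectorSpan ℝ S).mkQ.prodMap (LinearMap.id (R := ℝ) (M := ℝ))) ''
            tildeD (D j) P)) ∩ K).Nonempty).card := by
  subst hP
  have hSF := hS.1
  have hSP : S ⊆ convexHull ℝ (A : Set (Fin n → ℝ)) := face_sub hSF
  have hSO : ∀ s ∈ S, (vectorSpan ℝ S).mkQ s = O := fun s hs => by
    have : (vectorSpan ℝ S).mkQ s ∈ (vectorSpan ℝ S).mkQ '' S := ⟨s, hs, rfl⟩
    rw [hO] at this; exact this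
  have hSne : S.Nonempty := by
    have : ((vectorSpan ℝ S).mkQ '' S).Nonempty := by rw [hO]; exact Set.singleton_nonempty O
    exact this.of_image
  obtain ⟨s0, hs0⟩ := hSne
  have hOS : ∀ x ∈ convexHull ℝ (A : Set (Fin n → ℝ)), (vectorSpan ℝ S).mkQ x = O → x ∈ S := by
    intro x hx hxO
    obtain ⟨η, hη⟩ := hSF
    have hker : (vectorSpan ℝ S) ≤ LinearMap.ker η := by
      refine vspan_le fun a ha b hb => ?_
      rw [hη] at ha hb
      have := le_antisymm (ha.2 b hb.1) (hb.2 a ha.1)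
      rw [LinearMap.mem_ker, map_sub, this, sub_self]
    have h1 : x - s0 ∈ (vectorSpan ℝ S) := by
      rw [← Submodule.Quotient.mk_eq_zero (vectorSpan ℝ S), Submodule.Quotient.mk_sub, sub_eq_zero]
      have := hSO s0 hs0
      rw [← hxO] at this
      exact this.symm
    have h2 : η (x - s0) = 0 := hker h1
    rw [map_sub, sub_eq_zero] at h2
    rw [hη] at hs0 ⊢
    exact ⟨hx, fun y hy => by rw [h2]; exact hs0.2 y hy⟩
  have hOmax : O ∈ {x ∈ (vectorSpan ℝ S).mkQ '' convexHull ℝ (A : Set (Fin n → ℝ)) |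
        ∀ y ∈ (vectorSpan ℝ S).mkQ '' convexHull ℝ (A : Set (Fin n → ℝ)), ξ y ≤ ξ x} := by rw [hξ]; rfl
  have hle : ∀ x ∈ convexHull ℝ (A : Set (Fin n → ℝ)), ξ ((vectorSpan ℝ S).mkQ x) ≤ ξ O :=
    fun x hx => hOmax.2 _ ⟨x, hx, rfl⟩
  have hlt : ∀ x ∈ convexHull ℝ (A : Set (Fin n → ℝ)), x ∉ S → ξ ((vectorSpan ℝ S).mkQ x) < ξ O := by
    intro x hx hxS
    refine lt_of_le_of_ne (hle x hx) fun h => hxS (hOS x hx ?_)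
    have : (vectorSpan ℝ S).mkQ x ∈ {x ∈ (vectorSpan ℝ S).mkQ '' convexHull ℝ (A : Set (Fin n → ℝ)) |
        ∀ y ∈ (vectorSpan ℝ S).mkQ '' convexHull ℝ (A : Set (Fin n → ℝ)), ξ y ≤ ξ x} :=
      ⟨⟨x, hx, rfl⟩, fun y hy => by rw [h]; exact hOmax.2 y hy⟩
    rw [hξ] at this
    exact this
  -- elements of the projected set other than `O`
  have hproj : ∀ y ∈ projSet n A S \ {O}, ∃ a ∈ A, a ∉ S ∧ (vectorSpan ℝ S).mkQ a = y := by
    rintro y ⟨⟨⟨a, ha, rfl⟩, -⟩, hne⟩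
    exact ⟨a, ha, fun h => hne (hSO a h), rfl⟩
  let θ : (Fin n → ℝ) →ₗ[ℝ] ℝ := ξ ∘ₗ (vectorSpan ℝ S).mkQ
  have hθd : ∀ x, θ x = ξ ((vectorSpan ℝ S).mkQ x) := fun x => rfl
  have hOQ : O ∈ supFaceSlice ξ (tildeP (projSet n A S) O) := by
    rw [hcase]; exact subset_convexHull ℝ _ (Or.inl rfl)
  have hYQ : ∀ y ∈ Y, y ∈ supFaceSlice ξ (tildeP (projSet n A S) O) := by
    intro y hy; rw [hcase]; exact subset_convexHull ℝ _ (Or.inr hy)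
  -- the bound on `A \ S`
  have hθ : ∀ a ∈ A, a ∉ S → θ a ≤ ξ O - 1 := by
    by_cases hne : (A.filter (· ∉ S)).Nonempty
    swap
    · intro a ha haS
      exact absurd ⟨a, Finset.mem_filter.2 ⟨ha, haS⟩⟩ hne
    obtain ⟨a0, ha0, hmax⟩ := Finset.exists_max_image _ (fun x => θ x) hne
    rw [Finset.mem_filter] at ha0
    suffices h : θ a0 ≤ ξ O - 1 from fun a ha haS =>
      (hmax a (Finset.mem_filter.2 ⟨ha, haS⟩)).trans h
    have ha0P := subset_convexHull ℝ (A : Set (Fin n → ℝ)) ha0.1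
    have hδ : θ a0 < ξ O := hlt a0 ha0P ha0.2
    have hne0 : (vectorSpan ℝ S).mkQ a0 ≠ O := fun h => ha0.2 (hOS a0 ha0P h)
    have hcl : (vectorSpan ℝ S).mkQ a0 ∈ projSet n A S \ {O} := by
      refine ⟨⟨⟨a0, ha0.1, rfl⟩, ?_⟩, hne0⟩
      have hcont : Continuous fun t : ℝ => (vectorSpan ℝ S).mkQ (a0 + t • (s0 - a0)) := by
        have h1 : Continuous ((vectorSpan ℝ S).mkQ : (Fin n → ℝ) → _) := (vectorSpan ℝ S).mkQL.continuous
        exact h1.comp (by fun_prop)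
      have htend : Tendsto (fun t : ℝ => (vectorSpan ℝ S).mkQ (a0 + t • (s0 - a0)))
          (nhdsWithin 0 (Set.Ioi 0)) (nhds ((vectorSpan ℝ S).mkQ a0)) := by
        have := (hcont.tendsto 0).mono_left (nhdsWithin_le_nhds (s := Set.Ioi 0))
        simpa using this
      refine mem_closure_of_tendsto htend ?_
      have hev : ∀ᶠ t : ℝ in nhdsWithin 0 (Set.Ioi 0), t ∈ Set.Ioo (0:ℝ) 1 :=
        Ioo_mem_nhdsGT one_pos
      filter_upwards [hev] with t ht
      refine ⟨⟨_, (convex_convexHull ℝ _).add_smul_sub_mem ha0P (hSP hs0) ⟨ht.1.le, ht.2.le⟩, rfl⟩, ?_⟩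
      rintro ⟨z, hz, hz2⟩
      have h1 : θ z ≤ θ a0 := hull_le (fun x hx => hmax x (Finset.mem_filter.2 ⟨hx.1, hx.2⟩)) hz
      have h2 : θ z = θ (a0 + t • (s0 - a0)) := by rw [hθd, hθd, hz2]
      have h3 : θ s0 = ξ O := by rw [hθd, hSO s0 hs0]
      rw [map_add, map_smul, map_sub, h3, smul_eq_mul] at h2
      have := mul_pos ht.1 (sub_pos.2 hδ)
      linarith
    obtain ⟨⟨o, y⟩, ⟨hoy, hoymax⟩, rfl⟩ := hOQ
    simp only at *
    have hy1 := hoymax ((vectorSpan ℝ S).mkQ a0, 0) (subset_convexHull ℝ _ (Or.inl ⟨hcl, le_rfl⟩))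
    simp only at hy1
    let ℓ : (((Fin n → ℝ) ⧸ (vectorSpan ℝ S)) × ℝ) →ₗ[ℝ] ℝ :=
      ξ ∘ₗ LinearMap.fst ℝ _ ℝ + (ξ o - θ a0) • LinearMap.snd ℝ _ ℝ
    have hℓ : ∀ p, ℓ p = ξ p.1 + (ξ o - θ a0) * p.2 := fun p => by simp [ℓ]
    have hδ' : 0 < ξ o - θ a0 := sub_pos.2 hδ
    have hb : ℓ (o, y) ≤ θ a0 := by
      refine hull_le ?_ hoy
      rintro ⟨p, q⟩ (⟨h1, h2⟩ | ⟨h1, h2⟩)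
      · obtain ⟨a, ha, haS, haeq⟩ := hproj p h1
        have := hmax a (Finset.mem_filter.2 ⟨ha, haS⟩)
        rw [hθd, haeq] at this
        rw [hℓ]
        simp only at h2 ⊢
        nlinarith
      · rw [hℓ]
        simp only at h1 h2 ⊢
        rw [h1]
        nlinarith
    rw [hℓ] at hb
    simp only at hb
    have : y ≤ -1 := by
      by_contra hcon
      push Not at hcon
      nlinarith
    rw [hθd]
    linarith
  have hθS : ∀ s ∈ S, θ s = (ξ O - 1) + 1 := fun s hs => by rw [hθd, hSO s hs]; ring
  have hYc : ∀ y ∈ Y, ξ y = ξ O - 1 := by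
    intro y hy
    apply le_antisymm
    · rw [hY] at hy
      obtain ⟨a, ha, haS, rfl⟩ := hproj y hy.1
      exact hθ a ha haS
    · obtain ⟨⟨o, q⟩, ⟨hoy, hoymax⟩, rfl⟩ := hYQ y hy
      have h1 := hoymax (O, -1) (subset_convexHull ℝ _ (Or.inr ⟨rfl, le_rfl⟩))
      have h2 : (LinearMap.snd ℝ ((Fin n → ℝ) ⧸ (vectorSpan ℝ S)) ℝ) (o, q) ≤ 0 := by
        refine hull_le ?_ hoy
        rintro ⟨p, r⟩ (⟨h1, h2⟩ | ⟨h1, h2⟩)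
        · exact h2
        · simp only [LinearMap.snd_apply] at h2 ⊢
          linarith
      simp only [LinearMap.snd_apply] at h1 h2 ⊢
      linarith
  -- membership in the slices
  have hJd : ∀ j ∈ J, S ∩ D j = ∅ := by
    intro j hj
    rw [hJ, Finset.mem_filter] at hj
    rw [Set.inter_comm]
    exact Set.not_nonempty_iff_eq_empty.1 hj.2
  have hDle : ∀ j ∈ J, ∀ z ∈ D j, θ z ≤ ξ O - 1 := by
    intro j hj z hz
    have hd := (hsemi.1 j (Finset.mem_univ j)).2.2
    have hz' := hz
    rw [hd] at hz'
    refine hull_le (fun x hx => hθ x hx.1 fun hxS => ?_) hz'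
    have hxD : x ∈ D j := by rw [hd]; exact subset_convexHull ℝ _ hx
    have : x ∈ S ∩ D j := ⟨hxS, hxD⟩
    rw [hJd j hj] at this
    exact this
  have hslice : ∀ j ∈ J, ∀ p ∈ tildeD (D j) (convexHull ℝ (A : Set (Fin n → ℝ))),
      θ p.1 + p.2 = ξ O - 1 → (vectorSpan ℝ S).mkQ p.1 ∈ supFaceSlice ξ
        (((vectorSpan ℝ S).mkQ.prodMap (LinearMap.id (R := ℝ) (M := ℝ))) ''
          tildeD (D j) (convexHull ℝ (A : Set (Fin n → ℝ)))) := by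
    intro j hj p hp hpc
    refine ⟨((vectorSpan ℝ S).mkQ p.1, p.2), ⟨⟨p, hp, rfl⟩, ?_⟩, rfl⟩
    rintro _ ⟨q, hq, rfl⟩
    let ℓ : ((Fin n → ℝ) × ℝ) →ₗ[ℝ] ℝ := θ ∘ₗ LinearMap.fst ℝ _ ℝ + LinearMap.snd ℝ _ ℝ
    have hb : ℓ q ≤ ξ O - 1 := by
      refine hull_le ?_ hq
      rintro ⟨p, r⟩ (⟨h1, h2⟩ | ⟨h1, h2⟩)
      · have := hDle j hj p h1
        simp only [ℓ, LinearMap.add_apply, LinearMap.comp_apply, LinearMap.fst_apply,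
          LinearMap.snd_apply] at h2 ⊢
        linarith
      · have := hle p h1
        rw [← hθd] at this
        simp only [ℓ, LinearMap.add_apply, LinearMap.comp_apply, LinearMap.fst_apply,
          LinearMap.snd_apply] at h2 ⊢
        linarith
    calc _ = ℓ q := rfl
      _ ≤ ξ O - 1 := hb
      _ = _ := hpc.symm
  have hcardJ : J.card + Module.finrank ℝ (vectorSpan ℝ S) = n := by
    have h1 := hS.2
    have h2 := Finset.card_filter_add_card_filter_not (s := (Finset.univ : Finset (Fin n)))
      (fun i => (D i ∩ S).Nonempty)
    rw [Finset.card_univ, Fintype.card_fin] at h2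
    have h3 : sdim S = Module.finrank ℝ (vectorSpan ℝ S) := rfl
    rw [← h3, ← h1, add_comm, hJ]
    convert h2
  intro K hK hKne
  by_cases hOK : O ∈ K
  · -- `K` contains the apex
    have hdim : sdim K < Module.finrank ℝ ((Fin n → ℝ) ⧸ (vectorSpan ℝ S)) := by
      obtain ⟨ζ, hζ⟩ := hK
      have hq : ∃ q, q ∈ supFaceSlice ξ (tildeP (projSet n A S) O) ∧ q ∉ K := by
        by_contra hcon
        push Not at hcon
        apply hKne
        apply Set.Subset.antisymm _ hcon
        rw [hζ]; exact fun x hx => hx.1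
      obtain ⟨q, hqQ, hqK⟩ := hq
      have hle2 : vectorSpan ℝ K ≤ LinearMap.ker ζ := by
        refine vspan_le fun a ha b hb => ?_
        rw [hζ] at ha hb
        have := le_antisymm (ha.2 b hb.1) (hb.2 a ha.1)
        rw [LinearMap.mem_ker, map_sub, this, sub_self]
      refine Submodule.finrank_lt (lt_of_le_of_lt hle2 (lt_top_iff_ne_top.2 fun htop => hqK ?_)).ne
      have hz : ζ = 0 := LinearMap.ker_eq_top.1 htop
      rw [hζ, hz]
      exact ⟨hqQ, fun y _ => le_rfl⟩
    have hquot := Submodule.finrank_quotient_add_finrank (vectorSpan ℝ S)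
    rw [Module.finrank_fin_fun] at hquot
    have hle3 : J.card ≤ (J.filter fun j =>
        ((supFaceSlice ξ
          (((vectorSpan ℝ S).mkQ.prodMap (LinearMap.id (R := ℝ) (M := ℝ))) ''
            tildeD (D j) (convexHull ℝ (A : Set (Fin n → ℝ))))) ∩ K).Nonempty).card := by
      apply Finset.card_le_card
      intro j hj
      refine Finset.mem_filter.2 ⟨hj, O, ?_, hOK⟩
      have := hslice j hj (s0, -1) (subset_convexHull ℝ _ (Or.inr ⟨hSP hs0, le_rfl⟩))
        (by simp only [hθS s0 hs0]; ring)
      simp only [hSO s0 hs0] at this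
      exact this
    omega
  · -- `K` is a face of the base
    rw [hcase] at hK
    have hYfin : Y.Finite := by
      refine (A.finite_toSet.image (vectorSpan ℝ S).mkQ).subset ?_
      rw [hY]
      rintro y ⟨hy, -⟩
      obtain ⟨a, ha, -, rfl⟩ := hproj y hy
      exact ⟨a, ha, rfl⟩
    have hKhull := face_hull hK
    have hKY : ({O} ∪ Y) ∩ K ⊆ Y ∩ K := by
      rintro x ⟨h1 | h1, h2⟩
      · rw [Set.mem_singleton_iff] at h1
        rw [h1] at h2; exact absurd h2 hOK
      · exact ⟨h1, h2⟩
    have hKn : (Y ∩ K).Nonempty := by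
      obtain ⟨ζ, hζ⟩ := hK
      obtain ⟨x, hx, hxmax⟩ := Set.exists_max_image ({O} ∪ Y) (fun x => ζ x)
        ((Set.finite_singleton O).union hYfin) ⟨O, Or.inl rfl⟩
      refine ⟨x, hKY ⟨hx, ?_⟩⟩
      rw [hζ]
      exact ⟨subset_convexHull ℝ _ hx, fun y hy => hull_le hxmax hy⟩
    have hYA : ∀ y ∈ Y, ∃ a ∈ A, (vectorSpan ℝ S).mkQ a = y := by
      intro y hy
      rw [hY] at hy
      obtain ⟨a, ha, -, rfl⟩ := hproj y hy.1
      exact ⟨a, ha, rfl⟩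
    let B : Set (Fin n → ℝ) := {a | a ∈ A ∧ (vectorSpan ℝ S).mkQ a ∈ Y ∩ K}
    obtain ⟨F, hF, hBF, hFmin⟩ := exists_minface A (B := S ∪ B) ⟨s0, Or.inl hs0⟩
      (Set.union_subset hSP fun b hb => subset_convexHull ℝ _ hb.1)
    have hFconv : Convex ℝ F := by rw [face_hull hF]; exact convex_convexHull ℝ _
    have hKF : K ⊆ (vectorSpan ℝ S).mkQ '' F := by
      rw [hKhull]
      refine convexHull_min (hKY.trans ?_) (hFconv.linear_image (vectorSpan ℝ S).mkQ)
      rintro y ⟨hy, hyK⟩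
      obtain ⟨a, ha, rfl⟩ := hYA y hy
      exact ⟨a, hBF (Or.inr ⟨ha, hy, hyK⟩), rfl⟩
    have hKc : ∀ y ∈ K, ξ y = ξ O - 1 := by
      intro y hy
      rw [hKhull] at hy
      exact convexHull_min (t := {x | ξ x = ξ O - 1}) (fun x hx => hYc x (hKY hx).1)
        (convex_hyperplane ξ.isLinear _) hy
    have hdimF : Module.finrank ℝ (vectorSpan ℝ S) + (sdim K + 1) ≤ sdim F := by
      have hVF : (vectorSpan ℝ S) ≤ vectorSpan ℝ F := vectorSpan_mono ℝ fun s hs => hBF (Or.inl hs)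
      have hmap : Module.finrank ℝ ((vectorSpan ℝ F).map (vectorSpan ℝ S).mkQ) + Module.finrank ℝ (vectorSpan ℝ S)
          = Module.finrank ℝ (vectorSpan ℝ F) := by
        have h1 := LinearMap.finrank_range_add_finrank_ker ((vectorSpan ℝ S).mkQ.domRestrict (vectorSpan ℝ F))
        rw [LinearMap.range_domRestrict, LinearMap.ker_domRestrict, Submodule.ker_mkQ] at h1
        have h2 : Module.finrank ℝ ((vectorSpan ℝ S).submoduleOf (vectorSpan ℝ F)) = Module.finrank ℝ (vectorSpan ℝ S) :=
          (Submodule.submoduleOfEquivOfLe hVF).finrank_eq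
        rw [← h1, ← h2]
        rfl
      have hsub : ∀ x ∈ (vectorSpan ℝ S).mkQ '' F, ∀ y ∈ (vectorSpan ℝ S).mkQ '' F, x - y ∈ (vectorSpan ℝ F).map (vectorSpan ℝ S).mkQ := by
        rintro _ ⟨x, hx, rfl⟩ _ ⟨y, hy, rfl⟩
        exact ⟨x - y, vsub_mem_vectorSpan ℝ hx hy, by simp⟩
      have hKle : vectorSpan ℝ K ≤ (vectorSpan ℝ F).map (vectorSpan ℝ S).mkQ := by
        refine vspan_le fun a ha b hb => ?_
        exact hsub a (hKF ha) b (hKF hb)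
      have hKker : vectorSpan ℝ K ≤ LinearMap.ker ξ := by
        refine vspan_le fun a ha b hb => ?_
        rw [LinearMap.mem_ker, map_sub, hKc a ha, hKc b hb, sub_self]
      obtain ⟨y0, hy0⟩ := hKn
      have hlt2 : vectorSpan ℝ K < (vectorSpan ℝ F).map (vectorSpan ℝ S).mkQ := by
        refine lt_of_le_of_ne hKle fun heq => ?_
        have h1 := hsub y0 (hKF hy0.2) O ⟨s0, hBF (Or.inl hs0), hSO s0 hs0⟩
        rw [← heq] at h1
        have h2 : ξ (y0 - O) = 0 := hKker h1
        rw [map_sub, hKc y0 hy0.2] at h2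
        linarith
      have h3 := Submodule.finrank_lt_finrank_of_lt hlt2
      unfold sdim
      omega
    have hcnt := hsemi.2 F hF
    have hSc := hS.2
    have hsubset : (Finset.univ.filter fun i => (D i ∩ F).Nonempty) ⊆
        (Finset.univ.filter fun i => (D i ∩ S).Nonempty) ∪ (J.filter fun j =>
        ((supFaceSlice ξ
          (((vectorSpan ℝ S).mkQ.prodMap (LinearMap.id (R := ℝ) (M := ℝ))) ''
            tildeD (D j) (convexHull ℝ (A : Set (Fin n → ℝ))))) ∩ K).Nonempty) := by
      intro j hj
      rw [Finset.mem_filter] at hj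
      rw [Finset.mem_union]
      by_cases hjS : (D j ∩ S).Nonempty
      · exact Or.inl (Finset.mem_filter.2 ⟨Finset.mem_univ _, hjS⟩)
      right
      have hjJ : j ∈ J := by
        rw [hJ]; exact Finset.mem_filter.2 ⟨Finset.mem_univ _, hjS⟩
      refine Finset.mem_filter.2 ⟨hjJ, ?_⟩
      have hex : ∃ b ∈ B, b ∈ D j := by
        by_contra hcon
        push Not at hcon
        obtain ⟨G, hG, hSG⟩ := exists_DFam A (D j) hSF (hJd j hjJ)
        have hFG : F ⊆ G := by
          refine hFmin G hG.1.1 (Set.union_subset hSG fun b hb => ?_)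
          exact mem_of_rot A (D j) S G θ (ξ O - 1) (hsemi.1 j (Finset.mem_univ j)) hSF
            (hJd j hjJ) ⟨s0, hs0⟩ hθS hθ hG hSG b hb.1 (hYc _ hb.2.1) (hcon b hb)
        obtain ⟨x, hx1, hx2⟩ := hj.2
        have : x ∈ G ∩ D j := ⟨hFG hx2, hx1⟩
        rw [hG.1.2] at this
        exact this
      obtain ⟨b, hb, hbD⟩ := hex
      refine ⟨(vectorSpan ℝ S).mkQ b, ?_, hb.2.2⟩
      have hbc : θ b = ξ O - 1 := hYc _ hb.2.1
      exact hslice j hjJ (b, 0) (subset_convexHull ℝ _ (Or.inl ⟨hbD, le_rfl⟩))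
        (by simp only [hbc]; ring)
    have hc1 := (Finset.card_le_card hsubset).trans (Finset.card_union_le _ _)
    have h3 : sdim S = Module.finrank ℝ (vectorSpan ℝ S) := rfl
    omega


end
end
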